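/- arXiv:2104.07990 — 3 statements merged into one kernel-verified Lean document; each statement's English description precedes it below -/
import Mathlib

section
/- Let k0>0, L>0, n∈C¹([0,L],S²) and α∈C¹([0,L],ℝ). For every point (k1,k2,t) with k1²+k2²<k0² and t∈(0,L), the map T± is differentiable there and the absolute value of its Jacobian determinant equals (k0/κ(k1,k2))·| (1−cos α(t))·( n3(t)·(n′(t)·h) − n3′(t)·(n(t)·h) ) − n3(t)·( n(t)·(n′(t)×h) )·sin α(t) − α′(t)·( n1(t)k2 − n2(t)k1 ) + (n(t)·h)·( n1(t)n2′(t) − n2(t)n1′(t) )·sin α(t) |, where h = h±(k1,k2) = (k1,k2,±κ(k1,k2)−k0)ᵀ. Moreover, the function (k1,k2,t) ↦ |det ∇T±(k1,k2,t)| is integrable over U. -/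
open MeasureTheory Set

noncomputable section

/-- Euclidean dot product on ℝ³. -/
def dot3 (a b : Fin 3 → ℝ) : ℝ := a 0 * b 0 + a 1 * b 1 + a 2 * b 2

/-- Cross product on ℝ³. -/
def cross3 (a b : Fin 3 → ℝ) : Fin 3 → ℝ :=
  ![a 1 * b 2 - a 2 * b 1, a 2 * b 0 - a 0 * b 2, a 0 * b 1 - a 1 * b 0]

/-- Rotation about axis `n` by angle `θ` (Rodrigues' formula). -/
def rot3 (n : Fin 3 → ℝ) (θ : ℝ) (y : Fin 3 → ℝ) : Fin 3 → ℝ :=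
  fun i => (1 - Real.cos θ) * dot3 n y * n i + Real.cos θ * y i - Real.sin θ * cross3 n y i

/-- κ(k1,k2) = √(k0² − k1² − k2²) (real on the relevant region k1²+k2²<k0²). -/
def kappa (k0 k1 k2 : ℝ) : ℝ := Real.sqrt (k0 ^ 2 - k1 ^ 2 - k2 ^ 2)

/-- h±(k1,k2) = (k1, k2, ±κ − k0)ᵀ, where ε = ±1 encodes the sign. -/
def hpm (k0 ε k1 k2 : ℝ) : Fin 3 → ℝ := ![k1, k2, ε * kappa k0 k1 k2 - k0]

/-- T±(k1,k2,t) = R_{n(t),α(t)} h±(k1,k2), as a map ℝ³ → ℝ³. -/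
def Tmap (k0 ε : ℝ) (n : ℝ → Fin 3 → ℝ) (α : ℝ → ℝ) (p : Fin 3 → ℝ) : Fin 3 → ℝ :=
  rot3 (n (p 2)) (α (p 2)) (hpm k0 ε (p 0) (p 1))

/-- U = {(k1,k2,t) : k1²+k2² < k0², 0 ≤ t ≤ L}. -/
def Uset (k0 L : ℝ) : Set (Fin 3 → ℝ) :=
  {p | p 0 ^ 2 + p 1 ^ 2 < k0 ^ 2 ∧ p 2 ∈ Icc (0 : ℝ) L}

/-- The linear map with matrix `M`, as a continuous linear map. -/
def matrixCLM (M : Matrix (Fin 3) (Fin 3) ℝ) : (Fin 3 → ℝ) →L[ℝ] (Fin 3 → ℝ) :=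
  LinearMap.toContinuousLinearMap (Matrix.toLin' M)

lemma det_matrixCLM (M : Matrix (Fin 3) (Fin 3) ℝ) :
    LinearMap.det (matrixCLM M).toLinearMap = M.det := by
  simp [matrixCLM]

lemma matrixCLM_apply (M : Matrix (Fin 3) (Fin 3) ℝ) (v : Fin 3 → ℝ) (i : Fin 3) :
    matrixCLM M v i = M i 0 * v 0 + M i 1 * v 1 + M i 2 * v 2 := by
  simp [matrixCLM, Matrix.mulVec, dotProduct, Fin.sum_univ_three]

lemma kappa_sq {k0 k1 k2 : ℝ} (h : k1 ^ 2 + k2 ^ 2 < k0 ^ 2) :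
    kappa k0 k1 k2 ^ 2 = k0 ^ 2 - k1 ^ 2 - k2 ^ 2 :=
  Real.sq_sqrt (by linarith)

lemma kappa_pos {k0 k1 k2 : ℝ} (h : k1 ^ 2 + k2 ^ 2 < k0 ^ 2) : 0 < kappa k0 k1 k2 :=
  Real.sqrt_pos.2 (by linarith)

lemma continuous_kappa (k0 : ℝ) : Continuous fun p : Fin 3 → ℝ => kappa k0 (p 0) (p 1) := by
  unfold kappa
  fun_prop

lemma hasFDerivAt_coord (p : Fin 3 → ℝ) (i : Fin 3) :
    HasFDerivAt (fun q : Fin 3 → ℝ => q i)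
      (ContinuousLinearMap.proj (R := ℝ) (φ := fun _ : Fin 3 => ℝ) i) p :=
  (ContinuousLinearMap.proj (R := ℝ) (φ := fun _ : Fin 3 => ℝ) i).hasFDerivAt

lemma hasFDerivAt_kappa {k0 : ℝ} {p : Fin 3 → ℝ} (h : p 0 ^ 2 + p 1 ^ 2 < k0 ^ 2) :
    HasFDerivAt (fun q : Fin 3 → ℝ => kappa k0 (q 0) (q 1))
      ((-(p 0) / kappa k0 (p 0) (p 1)) •
          ContinuousLinearMap.proj (R := ℝ) (φ := fun _ : Fin 3 => ℝ) 0 +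
        (-(p 1) / kappa k0 (p 0) (p 1)) •
          ContinuousLinearMap.proj (R := ℝ) (φ := fun _ : Fin 3 => ℝ) 1) p := by
  have h0 := hasFDerivAt_coord p 0
  have h1 := hasFDerivAt_coord p 1
  have hk := kappa_pos h
  have := (((h0.pow 2).const_sub (k0 ^ 2)).sub (h1.pow 2)).sqrt (by
    exact ne_of_gt (by linarith : (0 : ℝ) < k0 ^ 2 - p 0 ^ 2 - p 1 ^ 2))
  refine this.congr_fderiv ?_
  ext v
  simp only [kappa] at hk
  simp [kappa]
  field_simp
  ring

/-- The derivative of the rotation matrix at `h` in the direction `(n', α')`. -/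
def rotDeriv (n n' : Fin 3 → ℝ) (a a' : ℝ) (h : Fin 3 → ℝ) : Fin 3 → ℝ := fun i =>
  Real.sin a * a' * dot3 n h * n i + (1 - Real.cos a) * (dot3 n' h * n i + dot3 n h * n' i)
    - Real.sin a * a' * h i - Real.cos a * a' * cross3 n h i - Real.sin a * cross3 n' h i

/-- The angular velocity of the rotation in the body frame. -/
def angVel (n n' : Fin 3 → ℝ) (a a' : ℝ) : Fin 3 → ℝ := fun i =>
  -a' * n i - Real.sin a * n' i - (1 - Real.cos a) * cross3 n n' i

lemma rotDeriv_eq_rot3 {n n' : Fin 3 → ℝ} (a a' : ℝ) (h : Fin 3 → ℝ)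
    (hn : dot3 n n = 1) (hnn' : dot3 n n' = 0) :
    rotDeriv n n' a a' h = rot3 n a (cross3 (angVel n n' a a') h) := by
  have hcs := Real.sin_sq_add_cos_sq a
  simp only [dot3] at hn hnn'
  funext i
  fin_cases i <;> simp [rotDeriv, rot3, angVel, dot3, cross3] <;>
  generalize Real.sin a = s at * <;> generalize Real.cos a = c at * <;>
  generalize n 0 = n0 at * <;> generalize n 1 = n1 at * <;> generalize n 2 = n2 at * <;>
  generalize n' 0 = m0 at * <;> generalize n' 1 = m1 at * <;> generalize n' 2 = m2 at * <;>
  generalize h 0 = h0 at * <;> generalize h 1 = h1 at * <;> generalize h 2 = h2 at * <;>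
  grind

/-- The Jacobian matrix of `Tmap`. -/
def jacT (k0 ε : ℝ) (n n' : Fin 3 → ℝ) (a a' : ℝ) (k1 k2 : ℝ) : Matrix (Fin 3) (Fin 3) ℝ :=
  Matrix.of fun i => ![rot3 n a ![1, 0, -(ε * k1 / kappa k0 k1 k2)] i,
    rot3 n a ![0, 1, -(ε * k2 / kappa k0 k1 k2)] i, rotDeriv n n' a a' (hpm k0 ε k1 k2) i]

lemma hasFDerivAt_Tmap {k0 ε : ℝ} {n : ℝ → Fin 3 → ℝ} {n' : Fin 3 → ℝ} {α : ℝ → ℝ} {a' : ℝ}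
    {p : Fin 3 → ℝ} (hp : p 0 ^ 2 + p 1 ^ 2 < k0 ^ 2) (hn : HasDerivAt n n' (p 2))
    (hα : HasDerivAt α a' (p 2)) :
    HasFDerivAt (Tmap k0 ε n α)
      (matrixCLM (jacT k0 ε (n (p 2)) n' (α (p 2)) a' (p 0) (p 1))) p := by
  have x0 := hasFDerivAt_coord p 0
  have x1 := hasFDerivAt_coord p 1
  have x2 := hasFDerivAt_coord p 2
  have hk := ((hasFDerivAt_kappa hp).const_mul ε).sub_const k0
  have hN : ∀ i, HasFDerivAt (fun q : Fin 3 → ℝ => n (q 2) i)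
      (n' i • ContinuousLinearMap.proj (R := ℝ) (φ := fun _ : Fin 3 => ℝ) 2) p := fun i =>
    HasDerivAt.comp_hasFDerivAt (h₂ := fun t => n t i) p (hasDerivAt_pi.1 hn i) x2
  have hA : HasFDerivAt (fun q : Fin 3 → ℝ => α (q 2))
      (a' • ContinuousLinearMap.proj (R := ℝ) (φ := fun _ : Fin 3 => ℝ) 2) p :=
    hα.comp_hasFDerivAt p x2
  have hd := (((hN 0).mul x0).add ((hN 1).mul x1)).add ((hN 2).mul hk)
  have hc := hA.cos.const_sub 1
  have c0 := ((hN 1).mul hk).sub ((hN 2).mul x1)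
  have c1 := ((hN 2).mul x0).sub ((hN 0).mul hk)
  have c2 := ((hN 0).mul x1).sub ((hN 1).mul x0)
  rw [hasFDerivAt_pi']
  intro i
  fin_cases i
  · refine ((((hc.mul hd).mul (hN 0)).add (hA.cos.mul x0)).sub (hA.sin.mul c0)).congr_fderiv ?_
    ext v
    simp [matrixCLM_apply, jacT, rot3, rotDeriv, dot3, cross3, hpm]
    ring
  · refine ((((hc.mul hd).mul (hN 1)).add (hA.cos.mul x1)).sub (hA.sin.mul c1)).congr_fderiv ?_
    ext v
    simp [matrixCLM_apply, jacT, rot3, rotDeriv, dot3, cross3, hpm]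
    ring
  · refine ((((hc.mul hd).mul (hN 2)).add (hA.cos.mul hk)).sub (hA.sin.mul c2)).congr_fderiv ?_
    ext v
    simp [matrixCLM_apply, jacT, rot3, rotDeriv, dot3, cross3, hpm]
    ring

/-- The matrix of a rotation. -/
def rotMatrix (n : Fin 3 → ℝ) (a : ℝ) : Matrix (Fin 3) (Fin 3) ℝ :=
  Matrix.of fun i => ![rot3 n a ![1, 0, 0] i, rot3 n a ![0, 1, 0] i, rot3 n a ![0, 0, 1] i]

lemma det_rotMatrix {n : Fin 3 → ℝ} (a : ℝ) (hn : dot3 n n = 1) : (rotMatrix n a).det = 1 := by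
  have hcs := Real.sin_sq_add_cos_sq a
  simp only [dot3] at hn
  simp [rotMatrix, Matrix.det_fin_three, rot3, dot3, cross3]
  generalize Real.sin a = s at *
  generalize Real.cos a = c at *
  generalize n 0 = n0 at *
  generalize n 1 = n1 at *
  generalize n 2 = n2 at *
  grind

/-- The columns of the Jacobian matrix of `Tmap`, rotated back to the body frame. -/
def bodyJac (k0 ε k1 k2 : ℝ) (w : Fin 3 → ℝ) : Matrix (Fin 3) (Fin 3) ℝ :=
  Matrix.of fun i => ![(![1, 0, -(ε * k1 / kappa k0 k1 k2)] : Fin 3 → ℝ) i,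
    (![0, 1, -(ε * k2 / kappa k0 k1 k2)] : Fin 3 → ℝ) i, cross3 w (hpm k0 ε k1 k2) i]

lemma jacT_eq_mul {n n' : Fin 3 → ℝ} (k0 ε a a' k1 k2 : ℝ)
    (hn : dot3 n n = 1) (hnn' : dot3 n n' = 0) :
    jacT k0 ε n n' a a' k1 k2 = rotMatrix n a * bodyJac k0 ε k1 k2 (angVel n n' a a') := by
  unfold jacT
  rw [rotDeriv_eq_rot3 a a' _ hn hnn']
  generalize angVel n n' a a' = w
  ext i j
  rw [Matrix.mul_apply, Fin.sum_univ_three]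
  fin_cases j <;> fin_cases i <;>
    simp [rotMatrix, bodyJac, rot3, dot3, cross3] <;> ring

lemma det_bodyJac {k0 ε k1 k2 : ℝ} (hε : ε ^ 2 = 1) (h : k1 ^ 2 + k2 ^ 2 < k0 ^ 2)
    (w : Fin 3 → ℝ) :
    (bodyJac k0 ε k1 k2 w).det =
      ε * (k0 / kappa k0 k1 k2) * cross3 w (hpm k0 ε k1 k2) 2 := by
  have hk := (kappa_pos h).ne'
  simp [bodyJac, Matrix.det_fin_three, cross3, hpm]
  field_simp
  linear_combination (w 1 * k1 - w 0 * k2) * kappa k0 k1 k2 * hε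

lemma cross3_angVel {n n' : Fin 3 → ℝ} (a a' : ℝ) (h : Fin 3 → ℝ)
    (hn : dot3 n n = 1) (hnn' : dot3 n n' = 0) :
    cross3 (angVel n n' a a') h 2 =
      (1 - Real.cos a) * (n 2 * dot3 n' h - n' 2 * dot3 n h) -
        n 2 * dot3 n (cross3 n' h) * Real.sin a - a' * (n 0 * h 1 - n 1 * h 0) +
        dot3 n h * (n 0 * n' 1 - n 1 * n' 0) * Real.sin a := by
  simp only [dot3] at hn hnn'
  simp [angVel, dot3, cross3]
  generalize Real.sin a = s at *
  generalize Real.cos a = c at *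
  generalize n 0 = n0 at *
  generalize n 1 = n1 at *
  generalize n 2 = n2 at *
  grind

lemma abs_det_jacT {k0 ε k1 k2 : ℝ} {n n' : Fin 3 → ℝ} (a a' : ℝ) (hk0 : 0 < k0)
    (hε : ε = 1 ∨ ε = -1) (h : k1 ^ 2 + k2 ^ 2 < k0 ^ 2)
    (hn : dot3 n n = 1) (hnn' : dot3 n n' = 0) :
    |(jacT k0 ε n n' a a' k1 k2).det| =
      k0 / kappa k0 k1 k2 * |cross3 (angVel n n' a a') (hpm k0 ε k1 k2) 2| := by
  have hε2 : ε ^ 2 = 1 := by rcases hε with rfl | rfl <;> norm_num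
  have hε1 : |ε| = 1 := by rcases hε with rfl | rfl <;> norm_num
  have hq : 0 ≤ k0 / kappa k0 k1 k2 := (div_pos hk0 (kappa_pos h)).le
  rw [jacT_eq_mul _ _ _ _ _ _ hn hnn', Matrix.det_mul, det_rotMatrix a hn, det_bodyJac hε2 h,
    one_mul, abs_mul, abs_mul, hε1, one_mul, abs_of_nonneg hq]

lemma dot3_deriv_eq_zero {n : ℝ → Fin 3 → ℝ} {n' : Fin 3 → ℝ} {t : ℝ} {s : Set ℝ}
    (hs : s ∈ nhds t) (hunit : ∀ u ∈ s, dot3 (n u) (n u) = 1) (hn : HasDerivAt n n' t) :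
    dot3 (n t) n' = 0 := by
  have hd := hasDerivAt_pi.1 hn
  have h1 := (((hd 0).mul (hd 0)).add ((hd 1).mul (hd 1))).add ((hd 2).mul (hd 2))
  have h2 : HasDerivAt (fun u => dot3 (n u) (n u)) 0 t :=
    (hasDerivAt_const t (1 : ℝ)).congr_of_eventuallyEq (Filter.eventually_of_mem hs hunit)
  have h3 := HasDerivAt.unique h1 h2
  simp only [dot3]
  linarith

/-- The Jacobian matrix of the map `p ↦ (p 2 + 1) • (p 0, p 1, κ(p 0, p 1))`. -/
def coneJac (k0 : ℝ) (p : Fin 3 → ℝ) : Matrix (Fin 3) (Fin 3) ℝ :=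
  !![p 2 + 1, 0, p 0; 0, p 2 + 1, p 1;
    -((p 2 + 1) * p 0 / kappa k0 (p 0) (p 1)), -((p 2 + 1) * p 1 / kappa k0 (p 0) (p 1)),
      kappa k0 (p 0) (p 1)]

/-- The map parametrizing a solid region between two hemispheres. -/
def coneMap (k0 : ℝ) (p : Fin 3 → ℝ) : Fin 3 → ℝ :=
  ![(p 2 + 1) * p 0, (p 2 + 1) * p 1, (p 2 + 1) * kappa k0 (p 0) (p 1)]

lemma hasFDerivAt_coneMap {k0 : ℝ} {p : Fin 3 → ℝ} (hp : p 0 ^ 2 + p 1 ^ 2 < k0 ^ 2) :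
    HasFDerivAt (coneMap k0) (matrixCLM (coneJac k0 p)) p := by
  have x2 := (hasFDerivAt_coord p 2).add_const 1
  rw [hasFDerivAt_pi']
  intro i
  fin_cases i
  · refine (x2.mul (hasFDerivAt_coord p 0)).congr_fderiv ?_
    ext v
    simp [matrixCLM_apply, coneJac]
  · refine (x2.mul (hasFDerivAt_coord p 1)).congr_fderiv ?_
    ext v
    simp [matrixCLM_apply, coneJac]
  · refine (x2.mul (hasFDerivAt_kappa hp)).congr_fderiv ?_
    ext v
    simp [matrixCLM_apply, coneJac]
    ring

lemma det_coneJac {k0 : ℝ} {p : Fin 3 → ℝ} (hp : p 0 ^ 2 + p 1 ^ 2 < k0 ^ 2) :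
    (coneJac k0 p).det = (p 2 + 1) ^ 2 * k0 ^ 2 / kappa k0 (p 0) (p 1) := by
  have hk := (kappa_pos hp).ne'
  simp [coneJac, Matrix.det_fin_three]
  field_simp
  linear_combination (p 2 + 1) ^ 2 * kappa_sq hp

/-- The interior of `Uset` with respect to the last variable. -/
def openU (k0 L : ℝ) : Set (Fin 3 → ℝ) :=
  {p | p 0 ^ 2 + p 1 ^ 2 < k0 ^ 2 ∧ p 2 ∈ Ioo (0 : ℝ) L}

lemma measurableSet_openU (k0 L : ℝ) : MeasurableSet (openU k0 L) := by
  have h1 : IsOpen {p : Fin 3 → ℝ | p 0 ^ 2 + p 1 ^ 2 < k0 ^ 2} :=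
    isOpen_lt (by fun_prop) (by fun_prop)
  have h2 : IsOpen {p : Fin 3 → ℝ | p 2 ∈ Ioo (0 : ℝ) L} :=
    isOpen_Ioo.preimage (continuous_apply 2)
  exact (h1.inter h2).measurableSet

lemma Uset_ae_le_openU (k0 L : ℝ) :
    Uset k0 L ≤ᵐ[(volume : Measure (Fin 3 → ℝ))] openU k0 L := by
  have hnull : ∀ x : ℝ, ∀ᵐ p : Fin 3 → ℝ, p 2 ≠ x := fun x => by
    rw [ae_iff]
    simpa [volume_pi] using Measure.pi_hyperplane (fun _ : Fin 3 => (volume : Measure ℝ)) 2 x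
  filter_upwards [hnull 0, hnull L] with p h0 hL hp
  exact ⟨hp.1, lt_of_le_of_ne hp.2.1 h0.symm, lt_of_le_of_ne hp.2.2 hL⟩

lemma abs_le_of_mem_disc {k0 x y : ℝ} (hk0 : 0 < k0) (h : x ^ 2 + y ^ 2 < k0 ^ 2) :
    |x| ≤ k0 ∧ |y| ≤ k0 ∧ kappa k0 x y ≤ k0 := by
  refine ⟨abs_le_of_sq_le_sq (by nlinarith) hk0.le, abs_le_of_sq_le_sq (by nlinarith) hk0.le, ?_⟩
  exact Real.sqrt_le_iff.2 ⟨hk0.le, by nlinarith⟩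

lemma injOn_coneMap {k0 : ℝ} (hk0 : 0 < k0) (L : ℝ) : InjOn (coneMap k0) (openU k0 L) := by
  intro p hp q hq h
  have e0 : (p 2 + 1) * p 0 = (q 2 + 1) * q 0 := congrFun h 0
  have e1 : (p 2 + 1) * p 1 = (q 2 + 1) * q 1 := congrFun h 1
  have e2 : (p 2 + 1) * kappa k0 (p 0) (p 1) = (q 2 + 1) * kappa k0 (q 0) (q 1) := congrFun h 2
  have hp2 : 0 < p 2 + 1 := by linarith [hp.2.1]
  have hq2 : 0 < q 2 + 1 := by linarith [hq.2.1]
  have e3 : ((p 2 + 1) * k0) ^ 2 = ((q 2 + 1) * k0) ^ 2 := by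
    have hp' := kappa_sq hp.1
    have hq' := kappa_sq hq.1
    calc ((p 2 + 1) * k0) ^ 2 = ((p 2 + 1) * p 0) ^ 2 + ((p 2 + 1) * p 1) ^ 2 +
          ((p 2 + 1) * kappa k0 (p 0) (p 1)) ^ 2 := by
          linear_combination -(p 2 + 1) ^ 2 * hp'
      _ = ((q 2 + 1) * q 0) ^ 2 + ((q 2 + 1) * q 1) ^ 2 +
          ((q 2 + 1) * kappa k0 (q 0) (q 1)) ^ 2 := by rw [e0, e1, e2]
      _ = ((q 2 + 1) * k0) ^ 2 := by linear_combination (q 2 + 1) ^ 2 * hq'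
  have e4 : p 2 + 1 = q 2 + 1 :=
    mul_right_cancel₀ hk0.ne' ((sq_eq_sq₀ (by positivity) (by positivity)).1 e3)
  rw [e4] at e0 e1
  funext i
  fin_cases i
  · exact mul_left_cancel₀ hq2.ne' e0
  · exact mul_left_cancel₀ hq2.ne' e1
  · exact add_right_cancel e4

lemma measurable_inv_kappa (k0 : ℝ) :
    Measurable fun p : Fin 3 → ℝ => (kappa k0 (p 0) (p 1))⁻¹ :=
  (continuous_kappa k0).measurable.inv

lemma integrableOn_inv_kappa {k0 L : ℝ} (hk0 : 0 < k0) :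
    IntegrableOn (fun p : Fin 3 → ℝ => (kappa k0 (p 0) (p 1))⁻¹) (openU k0 L) := by
  have himage : coneMap k0 '' openU k0 L ⊆
      Icc (fun _ => -((L + 1) * k0)) (fun _ => (L + 1) * k0) := by
    rintro _ ⟨p, hp, rfl⟩
    obtain ⟨b0, b1, b2⟩ := abs_le_of_mem_disc hk0 hp.1
    have hk := kappa_pos hp.1
    have hp2 : 0 < p 2 + 1 := by linarith [hp.2.1]
    have hL : p 2 + 1 ≤ L + 1 := by linarith [hp.2.2]
    have key : ∀ x, |x| ≤ k0 → |(p 2 + 1) * x| ≤ (L + 1) * k0 := fun x hx => by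
      rw [abs_mul, abs_of_pos hp2]
      gcongr
      linarith
    rw [← abs_of_pos hk] at b2
    rw [← pi_univ_Icc]
    intro i _
    rw [mem_Icc, ← abs_le]
    fin_cases i
    · exact key _ b0
    · exact key _ b1
    · exact key _ b2
  have hone : IntegrableOn (fun _ : Fin 3 → ℝ => (1 : ℝ)) (coneMap k0 '' openU k0 L) :=
    (continuous_const.integrableOn_Icc).mono_set himage
  rw [integrableOn_image_iff_integrableOn_abs_det_fderiv_smul volume (measurableSet_openU k0 L)
    (fun p hp => (hasFDerivAt_coneMap hp.1).hasFDerivWithinAt) (injOn_coneMap hk0 L)] at hone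
  refine (hone.const_mul (k0 ^ 2)⁻¹).mono' (measurable_inv_kappa k0).aestronglyMeasurable ?_
  filter_upwards [ae_restrict_mem (measurableSet_openU k0 L)] with p hp
  have hk := kappa_pos hp.1
  have hp2 : 1 ≤ (p 2 + 1) ^ 2 := by nlinarith [hp.2.1]
  have hd : (matrixCLM (coneJac k0 p)).det = (coneJac k0 p).det := det_matrixCLM _
  rw [hd, det_coneJac hp.1, Real.norm_of_nonneg (by positivity), abs_of_nonneg (by positivity),
    smul_eq_mul, mul_one]
  field_simp
  exact hp2

lemma exists_angVel_bound {k0 L ε : ℝ} (hL : 0 < L)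
    {n n' : ℝ → Fin 3 → ℝ} {α α' : ℝ → ℝ}
    (hn : ContDiffOn ℝ 1 n (Icc 0 L)) (hα : ContDiffOn ℝ 1 α (Icc 0 L))
    (hn' : ∀ t ∈ Ioo (0 : ℝ) L, HasDerivAt n (n' t) t)
    (hα' : ∀ t ∈ Ioo (0 : ℝ) L, HasDerivAt α (α' t) t) (hk0 : 0 < k0) :
    ∃ C, ∀ p ∈ openU k0 L, |cross3 (angVel (n (p 2)) (n' (p 2)) (α (p 2)) (α' (p 2)))
      (hpm k0 ε (p 0) (p 1)) 2| ≤ C := by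
  have hmaps : MapsTo (fun p : Fin 3 → ℝ => p 2)
      (Icc ![-k0, -k0, 0] ![k0, k0, L]) (Icc 0 L) := fun p hp => ⟨hp.1 2, hp.2 2⟩
  have hp2 : ContinuousOn (fun p : Fin 3 → ℝ => p 2) (Icc ![-k0, -k0, 0] ![k0, k0, L]) :=
    (continuous_apply 2).continuousOn
  have cn := hn.continuousOn.comp hp2 hmaps
  have cα := hα.continuousOn.comp hp2 hmaps
  have cn' := (hn.continuousOn_derivWithin (uniqueDiffOn_Icc hL) le_rfl).comp hp2 hmaps
  have cα' := (hα.continuousOn_derivWithin (uniqueDiffOn_Icc hL) le_rfl).comp hp2 hmaps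
  rw [continuousOn_pi] at cn cn'
  simp only [Function.comp_def] at cn cα cn' cα'
  have cs := Real.continuous_sin.comp_continuousOn cα
  have cc := Real.continuous_cos.comp_continuousOn cα
  have cn0 := cn 0
  have cn1 := cn 1
  have cn2 := cn 2
  have cm0 := cn' 0
  have cm1 := cn' 1
  have cm2 := cn' 2
  have hcont : ContinuousOn (fun p : Fin 3 → ℝ => cross3 (angVel (n (p 2))
      (derivWithin n (Icc 0 L) (p 2)) (α (p 2)) (derivWithin α (Icc 0 L) (p 2)))
      (hpm k0 ε (p 0) (p 1)) 2) (Icc ![-k0, -k0, 0] ![k0, k0, L]) := by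
    simp [cross3, angVel, hpm]
    exact ((((cα'.mul cn0).neg.sub (cs.mul cm0)).sub ((continuousOn_const.sub cc).mul
      ((cn1.mul cm2).sub (cn2.mul cm1)))).mul (continuous_apply 1).continuousOn).sub
      ((((cα'.mul cn1).neg.sub (cs.mul cm1)).sub ((continuousOn_const.sub cc).mul
      ((cn2.mul cm0).sub (cn0.mul cm2)))).mul (continuous_apply 0).continuousOn)
  obtain ⟨C, hC⟩ := isCompact_Icc.exists_bound_of_continuousOn hcont
  refine ⟨C, fun p hp => ?_⟩
  have hud := uniqueDiffOn_Icc hL _ (Ioo_subset_Icc_self hp.2)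
  have h1 := (hn' _ hp.2).hasDerivWithinAt.derivWithin hud
  have h2 := (hα' _ hp.2).hasDerivWithinAt.derivWithin hud
  obtain ⟨b0, b1, -⟩ := abs_le_of_mem_disc hk0 hp.1
  rw [abs_le] at b0 b1
  have := hC p ⟨fun i => by fin_cases i; exacts [b0.1, b1.1, hp.2.1.le],
    fun i => by fin_cases i; exacts [b0.2, b1.2, hp.2.2.le]⟩
  rwa [h1, h2, Real.norm_eq_abs] at this

theorem stmt0 (k0 L ε : ℝ) (hk0 : 0 < k0) (hL : 0 < L) (hε : ε = 1 ∨ ε = -1)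
    (n n' : ℝ → Fin 3 → ℝ) (α α' : ℝ → ℝ)
    (hn : ContDiffOn ℝ 1 n (Icc 0 L)) (hα : ContDiffOn ℝ 1 α (Icc 0 L))
    (hunit : ∀ t ∈ Icc (0 : ℝ) L, dot3 (n t) (n t) = 1)
    (hn' : ∀ t ∈ Ioo (0 : ℝ) L, HasDerivAt n (n' t) t)
    (hα' : ∀ t ∈ Ioo (0 : ℝ) L, HasDerivAt α (α' t) t) :
    (∀ k1 k2 t : ℝ, k1 ^ 2 + k2 ^ 2 < k0 ^ 2 → t ∈ Ioo (0 : ℝ) L →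
      DifferentiableAt ℝ (Tmap k0 ε n α) ![k1, k2, t] ∧
      |LinearMap.det (fderiv ℝ (Tmap k0 ε n α) ![k1, k2, t]).toLinearMap| =
        k0 / kappa k0 k1 k2 *
          |(1 - Real.cos (α t)) *
              (n t 2 * dot3 (n' t) (hpm k0 ε k1 k2) -
               n' t 2 * dot3 (n t) (hpm k0 ε k1 k2)) -
            n t 2 * dot3 (n t) (cross3 (n' t) (hpm k0 ε k1 k2)) * Real.sin (α t) -
            α' t * (n t 0 * k2 - n t 1 * k1) +
            dot3 (n t) (hpm k0 ε k1 k2) * (n t 0 * n' t 1 - n t 1 * n' t 0) *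
              Real.sin (α t)|) ∧
    IntegrableOn
      (fun p => |LinearMap.det (fderiv ℝ (Tmap k0 ε n α) p).toLinearMap|)
      (Uset k0 L) volume := by
  have hjac : ∀ p ∈ openU k0 L, HasFDerivAt (Tmap k0 ε n α)
      (matrixCLM (jacT k0 ε (n (p 2)) (n' (p 2)) (α (p 2)) (α' (p 2)) (p 0) (p 1))) p :=
    fun p hp => hasFDerivAt_Tmap hp.1 (hn' _ hp.2) (hα' _ hp.2)
  have horth : ∀ t ∈ Ioo (0 : ℝ) L, dot3 (n t) (n' t) = 0 := fun t ht =>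
    dot3_deriv_eq_zero (Icc_mem_nhds ht.1 ht.2) hunit (hn' t ht)
  have hdet : ∀ p ∈ openU k0 L,
      |LinearMap.det (fderiv ℝ (Tmap k0 ε n α) p).toLinearMap| =
        k0 / kappa k0 (p 0) (p 1) * |cross3 (angVel (n (p 2)) (n' (p 2)) (α (p 2)) (α' (p 2)))
          (hpm k0 ε (p 0) (p 1)) 2| := fun p hp => by
    rw [(hjac p hp).fderiv, det_matrixCLM, abs_det_jacT _ _ hk0 hε hp.1
      (hunit _ ⟨hp.2.1.le, hp.2.2.le⟩) (horth _ hp.2)]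
  refine ⟨fun k1 k2 t hk ht => ?_, ?_⟩
  · have hp : ![k1, k2, t] ∈ openU k0 L := ⟨hk, ht⟩
    refine ⟨(hjac _ hp).differentiableAt, (hdet _ hp).trans ?_⟩
    rw [cross3_angVel _ _ _ (hunit _ ⟨hp.2.1.le, hp.2.2.le⟩) (horth _ hp.2)]
    rfl
  · refine IntegrableOn.mono_set_ae ?_ (Uset_ae_le_openU k0 L)
    obtain ⟨C, hC⟩ := exists_angVel_bound (ε := ε) hL hn hα hn' hα' hk0
    have hmeas : Measurable fun p => |LinearMap.det (fderiv ℝ (Tmap k0 ε n α) p).toLinearMap| :=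
      (continuous_abs.comp ContinuousLinearMap.continuous_det).measurable.comp
        (measurable_fderiv ℝ (Tmap k0 ε n α))
    refine ((integrableOn_inv_kappa (L := L) hk0).const_mul (k0 * C)).mono'
      hmeas.aestronglyMeasurable ?_
    filter_upwards [ae_restrict_mem (measurableSet_openU k0 L)] with p hp
    have hk := kappa_pos hp.1
    rw [Real.norm_eq_abs, abs_abs, hdet p hp]
    calc k0 / kappa k0 (p 0) (p 1) * _ ≤ k0 / kappa k0 (p 0) (p 1) * C := by
          gcongr
          exact hC p hp
      _ = k0 * C * (kappa k0 (p 0) (p 1))⁻¹ := by ring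
end
end

section
/- Let k0>0 and ε>0, and define G_ε(r) = e^{(i k0 − ε)‖r‖}/(4π‖r‖) for r∈ℝ³\{0}. For every fixed r3∈ℝ, the function (r1,r2) ↦ G_ε(r1,r2,r3) is integrable on ℝ², and its two-dimensional Fourier transform equals (2π)^{−1} ∫_{ℝ²} G_ε(r1,r2,r3) e^{−i(k1r1+k2r2)} d(r1,r2) = i·e^{i κ_ε |r3|} / (4π κ_ε) for all (k1,k2)∈ℝ², where κ_ε = κ_ε(k1,k2) is the principal square root (the one with positive imaginary part) of (k0+iε)² − k1² − k2². -/
open MeasureTheory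

noncomputable section

/-- κ_ε(k1,k2): the principal square root (positive imaginary part) of
(k0+iε)² − k1² − k2². -/
def kappaEps (k0 ε k1 k2 : ℝ) : ℂ :=
  (((k0 : ℂ) + Complex.I * (ε : ℂ)) ^ 2 - (k1 : ℂ) ^ 2 - (k2 : ℂ) ^ 2) ^ ((1 : ℂ) / 2)

/-- G_ε(r1,r2,r3) = e^{(i k0 − ε)‖r‖}/(4π‖r‖) written in coordinates. -/
def GepsCoord (k0 ε r1 r2 r3 : ℝ) : ℂ :=
  Complex.exp ((Complex.I * (k0 : ℂ) - (ε : ℂ)) *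
      ((Real.sqrt (r1 ^ 2 + r2 ^ 2 + r3 ^ 2) : ℝ) : ℂ)) /
    (4 * (Real.pi : ℂ) * ((Real.sqrt (r1 ^ 2 + r2 ^ 2 + r3 ^ 2) : ℝ) : ℂ))

lemma half_cpow_sq (w : ℂ) : (w ^ ((1 : ℂ) / 2)) ^ 2 = w := by
  have h := Complex.cpow_nat_inv_pow w (n := 2) two_ne_zero
  rwa [Nat.cast_ofNat, ← one_div] at h

lemma half_cpow_re_pos {w : ℂ} (hw : w ∈ Complex.slitPlane) :
    0 < (w ^ ((1 : ℂ) / 2)).re := by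
  have h0 : w ≠ 0 := Complex.slitPlane_ne_zero hw
  have him : (Complex.log w * (1 / 2)).im = w.arg / 2 := by
    simp [Complex.mul_im, Complex.log_im]; ring
  rw [Complex.cpow_def_of_ne_zero h0, Complex.exp_re, him]
  have h1 := (Complex.arg_le_pi w).lt_of_ne (Complex.mem_slitPlane_iff_arg.mp hw).1
  have h2 := Complex.neg_pi_lt_arg w
  exact mul_pos (Real.exp_pos _) (Real.cos_pos_of_mem_Ioo ⟨by linarith, by linarith⟩)

lemma half_cpow_im_pos {w : ℂ} (hw : 0 < w.im) : 0 < (w ^ ((1 : ℂ) / 2)).im := by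
  have h0 : w ≠ 0 := by
    rintro rfl
    simp at hw
  have him : (Complex.log w * (1 / 2)).im = w.arg / 2 := by
    simp [Complex.mul_im, Complex.log_im]; ring
  rw [Complex.cpow_def_of_ne_zero h0, Complex.exp_im, him]
  have h1 := Complex.arg_le_pi w
  have h2 : 0 < w.arg := (Complex.arg_nonneg_iff.mpr hw.le).lt_of_ne fun h ↦ by
    have := (Complex.arg_eq_zero_iff.mp h.symm).2
    exact hw.ne' this
  exact mul_pos (Real.exp_pos _) (Real.sin_pos_of_pos_of_lt_pi (by linarith) (by linarith))

lemma eq_of_sq_eq_of_re_pos {u v : ℂ} (hu : 0 < u.re) (hv : 0 < v.re) (h : u ^ 2 = v ^ 2) :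
    u = v := by
  rcases sq_eq_sq_iff_eq_or_eq_neg.mp h with h | h
  · exact h
  · rw [h, Complex.neg_re] at hu
    linarith

lemma mul_mem_slitPlane_of_re_pos {u v : ℂ} (hu : 0 < u.re) (hv : 0 < v.re) :
    u * v ∈ Complex.slitPlane := by
  rw [Complex.mem_slitPlane_iff]
  by_contra! h
  obtain ⟨h1, h2⟩ := h
  rw [Complex.mul_re] at h1
  rw [Complex.mul_im] at h2
  have h3 : u.re * (u.re * v.re - u.im * v.im) = v.re * (u.re ^ 2 + u.im ^ 2) := by
    linear_combination -u.im * h2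
  have : 0 < v.re * (u.re ^ 2 + u.im ^ 2) := by positivity
  nlinarith

/-- The integrand `exp (-a ‖r‖ + b₁ r₁ + b₂ r₂) / ‖r‖` on the horizontal plane at height `z`,
with complex decay rate `a` and complex tilts `b₁`, `b₂`. -/
def tiltedYukawa (z : ℝ) (a b₁ b₂ : ℂ) (p : ℝ × ℝ) : ℂ :=
  Complex.exp (-a * (√(p.1 ^ 2 + p.2 ^ 2 + z ^ 2) : ℝ) + b₁ * p.1 + b₂ * p.2) /
    (√(p.1 ^ 2 + p.2 ^ 2 + z ^ 2) : ℝ)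

lemma measurable_tiltedYukawa (z : ℝ) (a b₁ b₂ : ℂ) : Measurable (tiltedYukawa z a b₁ b₂) := by
  unfold tiltedYukawa
  fun_prop

lemma integrable_exp_neg_mul_norm {d : ℝ} (hd : 0 < d) :
    Integrable (fun p : ℝ × ℝ ↦ Real.exp (-d * ‖p‖)) := by
  have h := (integrable_fun_norm_addHaar (volume : Measure (ℝ × ℝ))
    (f := fun t ↦ Real.exp (-d * t))).mpr
  apply h
  have := integrableOn_rpow_mul_exp_neg_mul_rpow (p := 1) (s := 1) (by norm_num) one_pos hd
  simpa using this

lemma integrable_exp_neg_mul_norm_div {d : ℝ} (hd : 0 < d) :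
    Integrable (fun p : ℝ × ℝ ↦ Real.exp (-d * ‖p‖) / ‖p‖) := by
  have h := (integrable_fun_norm_addHaar (volume : Measure (ℝ × ℝ))
    (f := fun t ↦ Real.exp (-d * t) / t)).mpr
  apply h
  refine (exp_neg_integrableOn_Ioi 0 hd).congr_fun (fun t ht ↦ ?_) measurableSet_Ioi
  have ht' : t ≠ 0 := (Set.mem_Ioi.mp ht).ne'
  simp
  field_simp

lemma norm_le_sqrt_add (p : ℝ × ℝ) (z : ℝ) : ‖p‖ ≤ √(p.1 ^ 2 + p.2 ^ 2 + z ^ 2) := by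
  rw [Prod.norm_def]
  refine max_le ?_ ?_ <;> refine Real.abs_le_sqrt ?_ <;>
    nlinarith [sq_nonneg p.1, sq_nonneg p.2, sq_nonneg z]

lemma abs_add_mul_le (c₁ c₂ : ℝ) (p : ℝ × ℝ) (z : ℝ) :
    |c₁ * p.1 + c₂ * p.2| ≤ √(c₁ ^ 2 + c₂ ^ 2) * √(p.1 ^ 2 + p.2 ^ 2 + z ^ 2) := by
  rw [← Real.sqrt_mul (by positivity)]
  refine Real.abs_le_sqrt ?_
  nlinarith [sq_nonneg (c₁ * p.2 - c₂ * p.1), mul_nonneg (sq_nonneg c₁) (sq_nonneg z),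
    mul_nonneg (sq_nonneg c₂) (sq_nonneg z)]

lemma norm_tiltedYukawa_le {z d : ℝ} {a b₁ b₂ : ℂ}
    (h : √(b₁.re ^ 2 + b₂.re ^ 2) ≤ a.re - d) (p : ℝ × ℝ) :
    ‖tiltedYukawa z a b₁ b₂ p‖ ≤
      Real.exp (-d * √(p.1 ^ 2 + p.2 ^ 2 + z ^ 2)) / √(p.1 ^ 2 + p.2 ^ 2 + z ^ 2) := by
  unfold tiltedYukawa
  rw [norm_div, Complex.norm_exp, Complex.norm_real, Real.norm_of_nonneg (Real.sqrt_nonneg _)]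
  gcongr
  have h1 := (le_abs_self _).trans (abs_add_mul_le b₁.re b₂.re p z)
  have h2 := mul_le_mul_of_nonneg_right h (Real.sqrt_nonneg (p.1 ^ 2 + p.2 ^ 2 + z ^ 2))
  simp only [Complex.add_re, Complex.mul_re, Complex.neg_re, Complex.ofReal_re, Complex.neg_im,
    Complex.ofReal_im, mul_zero, sub_zero]
  linarith

lemma integrable_tiltedYukawa (z : ℝ) {a b₁ b₂ : ℂ} (h : √(b₁.re ^ 2 + b₂.re ^ 2) < a.re) :
    Integrable (tiltedYukawa z a b₁ b₂) := by
  have hd : 0 < a.re - √(b₁.re ^ 2 + b₂.re ^ 2) := by linarith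
  refine (integrable_exp_neg_mul_norm_div hd).mono'
    (measurable_tiltedYukawa z a b₁ b₂).aestronglyMeasurable ?_
  have h0 : ∀ᵐ p : ℝ × ℝ, p ≠ 0 := Measure.ae_ne volume 0
  filter_upwards [h0] with p hp
  refine (norm_tiltedYukawa_le (sub_sub_cancel a.re _).ge p).trans ?_
  have hp' : 0 < ‖p‖ := norm_pos_iff.mpr hp
  have := norm_le_sqrt_add p z
  gcongr ?_ / ?_
  rw [Real.exp_le_exp]
  nlinarith

lemma integral_tiltedYukawa_swap (z : ℝ) (a b₁ b₂ : ℂ) :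
    ∫ p, tiltedYukawa z a b₁ b₂ p = ∫ p, tiltedYukawa z a b₂ b₁ p := by
  have h := integral_prod_swap (μ := (volume : Measure ℝ)) (ν := (volume : Measure ℝ))
    (tiltedYukawa z a b₁ b₂)
  rw [← Measure.volume_eq_prod] at h
  rw [← h]
  refine integral_congr_ae (ae_of_all _ fun p ↦ ?_)
  simp only [tiltedYukawa, Prod.fst_swap, Prod.snd_swap, add_comm (p.2 ^ 2) (p.1 ^ 2)]
  ring_nf

lemma sqrt_sq_mul_sinh_add_sq {s : ℝ} (hs : 0 < s) (t : ℝ) :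
    √((s * Real.sinh t) ^ 2 + s ^ 2) = s * Real.cosh t := by
  have := Real.cosh_pos t
  rw [← Real.sqrt_sq (by positivity : 0 ≤ s * Real.cosh t), mul_pow, mul_pow, Real.cosh_sq]
  ring_nf

/-- Parametrizing a hyperbola by rapidity turns `dx / √(x² + s²)` into the Lebesgue measure. -/
lemma integral_div_sqrt_eq_integral_sinh (f : ℝ → ℂ) {s : ℝ} (hs : 0 < s) :
    ∫ x, f x / (√(x ^ 2 + s ^ 2) : ℝ) = ∫ t, f (s * Real.sinh t) := by
  have hsurj : (fun t ↦ s * Real.sinh t) '' Set.univ = Set.univ := by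
    rw [Set.image_univ, Set.range_eq_univ]
    exact (mul_left_surjective₀ hs.ne').comp Real.sinh_surjective
  have hinj : Set.InjOn (fun t ↦ s * Real.sinh t) Set.univ := fun x _ y _ h ↦
    Real.sinh_injective (mul_left_cancel₀ hs.ne' h)
  have h := integral_image_eq_integral_abs_deriv_smul MeasurableSet.univ
    (fun t _ ↦ ((Real.hasDerivAt_sinh t).const_mul s).hasDerivWithinAt) hinj
    (fun x ↦ f x / (√(x ^ 2 + s ^ 2) : ℝ))
  rw [hsurj] at h
  simp only [Measure.restrict_univ] at h
  rw [h]
  refine integral_congr_ae (ae_of_all _ fun t ↦ ?_)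
  have hc := Real.cosh_pos t
  have hne : ((s * Real.cosh t : ℝ) : ℂ) ≠ 0 := by
    exact_mod_cast (by positivity : s * Real.cosh t ≠ 0)
  simp only [sqrt_sq_mul_sinh_add_sq hs, abs_of_pos (by positivity : 0 < s * Real.cosh t),
    Complex.real_smul]
  field_simp

/-- Invariance under a Lorentz boost of velocity `l`, along one line. -/
lemma integral_boost_line (a C : ℂ) {s c l : ℝ} (hs : 0 < s) (hc : 0 < c) (hl : c ^ 2 + l ^ 2 = 1) :
    ∫ x : ℝ, Complex.exp (-a * (√(x ^ 2 + s ^ 2) : ℝ) + (l * a) * x + C) /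
        (√(x ^ 2 + s ^ 2) : ℝ) =
      ∫ x : ℝ, Complex.exp (-(c * a) * (√(x ^ 2 + s ^ 2) : ℝ) + C) / (√(x ^ 2 + s ^ 2) : ℝ) := by
  rw [integral_div_sqrt_eq_integral_sinh (fun x : ℝ ↦
      Complex.exp (-a * (√(x ^ 2 + s ^ 2) : ℝ) + (l * a) * x + C)) hs,
    integral_div_sqrt_eq_integral_sinh (fun x : ℝ ↦
      Complex.exp (-(c * a) * (√(x ^ 2 + s ^ 2) : ℝ) + C)) hs]
  simp only [sqrt_sq_mul_sinh_add_sq hs]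
  have hsinh := Real.sinh_arsinh (l / c)
  have hcosh : Real.cosh (Real.arsinh (l / c)) = 1 / c := by
    rw [Real.cosh_arsinh, ← Real.sqrt_sq (by positivity : 0 ≤ 1 / c)]
    congr 1
    field_simp
    linarith
  rw [← integral_sub_right_eq_self (fun t : ℝ ↦
    Complex.exp (-(c * a) * (s * Real.cosh t : ℝ) + C)) (Real.arsinh (l / c))]
  refine integral_congr_ae (ae_of_all _ fun t ↦ ?_)
  have hcc : (c : ℂ) ≠ 0 := by exact_mod_cast hc.ne'
  simp only [Real.cosh_sub, hsinh, hcosh]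
  congr 1
  push_cast
  field_simp
  ring

/-- Invariance under a Lorentz boost of velocity `l` in the first coordinate. -/
lemma integral_tiltedYukawa_boost (z : ℝ) (a b : ℂ) {c l : ℝ} (hc : 0 < c)
    (hl : c ^ 2 + l ^ 2 = 1) (ha : 0 < a.re) (hb : |b.re| < c * a.re) :
    ∫ p, tiltedYukawa z a (l * a) b p = ∫ p, tiltedYukawa z (c * a) 0 b p := by
  have h1 : Integrable (tiltedYukawa z a (l * a) b) := by
    refine integrable_tiltedYukawa z ?_
    rw [Real.sqrt_lt' ha, Complex.re_ofReal_mul, ← sq_abs b.re]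
    have := pow_lt_pow_left₀ hb (abs_nonneg _) two_ne_zero
    nlinarith
  have h2 : Integrable (tiltedYukawa z (c * a) 0 b) := by
    refine integrable_tiltedYukawa z ?_
    simpa [Real.sqrt_sq_eq_abs] using hb
  rw [Measure.volume_eq_prod] at h1 h2 ⊢
  rw [integral_prod_symm _ h1, integral_prod_symm _ h2]
  have h0 : ∀ᵐ y : ℝ, y ≠ 0 := Measure.ae_ne volume 0
  refine integral_congr_ae ?_
  filter_upwards [h0] with y hy
  have hs : 0 < √(y ^ 2 + z ^ 2) := Real.sqrt_pos.mpr (by positivity)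
  have h := integral_boost_line a (b * y) hs hc hl
  rw [Real.sq_sqrt (by positivity)] at h
  simpa [tiltedYukawa, add_assoc] using h

lemma integral_tiltedYukawa_zero (z : ℝ) {a : ℂ} (ha : 0 < a.re) :
    ∫ p, tiltedYukawa z a 0 0 p = 2 * Real.pi * (Complex.exp (-a * (|z| : ℝ)) / a) := by
  have ha0 : a ≠ 0 := by
    rintro rfl
    simp at ha
  set g : ℝ → ℂ := fun r ↦ r * Complex.exp (-a * (√(r ^ 2 + z ^ 2) : ℝ)) / (√(r ^ 2 + z ^ 2) : ℝ)
    with hg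
  have hint : ∫ r in Set.Ioi (0 : ℝ), g r = Complex.exp (-a * (|z| : ℝ)) / a := by
    have hderiv (r : ℝ) (hr : r ∈ Set.Ioi (0 : ℝ)) : HasDerivAt
        (fun r : ℝ ↦ -(Complex.exp (-a * (√(r ^ 2 + z ^ 2) : ℝ)) / a)) (g r) r := by
      have hr' : 0 < r := hr
      have hpos : 0 < r ^ 2 + z ^ 2 := by positivity
      have hR : ((√(r ^ 2 + z ^ 2) : ℝ) : ℂ) ≠ 0 := by
        exact_mod_cast (Real.sqrt_pos.mpr hpos).ne'
      have h1 := (((hasDerivAt_pow 2 r).add_const (z ^ 2)).sqrt hpos.ne').ofReal_comp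
      have h2 := (((h1.const_mul (-a)).cexp).div_const a).neg
      refine h2.congr_deriv ?_
      simp only [hg]
      push_cast
      field_simp
    have hbound : IntegrableOn g (Set.Ioi 0) := by
      refine (exp_neg_integrableOn_Ioi 0 ha).mono' ?_ ?_
      · exact Measurable.aestronglyMeasurable (by fun_prop)
      · refine (ae_restrict_iff' measurableSet_Ioi).mpr (ae_of_all _ fun r hr ↦ ?_)
        have hr' : 0 < r := hr
        have hR : r ≤ √(r ^ 2 + z ^ 2) := Real.le_sqrt_of_sq_le (by nlinarith [sq_nonneg z])
        simp only [hg, norm_div, norm_mul, Complex.norm_exp, Complex.norm_real,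
          Real.norm_of_nonneg (Real.sqrt_nonneg _), Real.norm_of_nonneg hr'.le]
        rw [div_le_iff₀ (by linarith), mul_comm]
        gcongr
        simp
        gcongr
    have hlim : Filter.Tendsto
        (fun r : ℝ ↦ -(Complex.exp (-a * (√(r ^ 2 + z ^ 2) : ℝ)) / a)) Filter.atTop (nhds 0) := by
      rw [← neg_zero, ← zero_div a]
      refine (Filter.Tendsto.div_const ?_ a).neg
      rw [tendsto_zero_iff_norm_tendsto_zero]
      simp only [Complex.norm_exp]
      refine Real.tendsto_exp_atBot.comp ?_
      have : Filter.Tendsto (fun r : ℝ ↦ √(r ^ 2 + z ^ 2)) Filter.atTop Filter.atTop :=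
        Real.tendsto_sqrt_atTop.comp (Filter.tendsto_atTop_add_const_right _ _
          (Filter.tendsto_pow_atTop two_ne_zero))
      simpa using this.const_mul_atTop_of_neg (neg_lt_zero.mpr ha)
    rw [integral_Ioi_of_hasDerivAt_of_tendsto (Continuous.continuousWithinAt (by fun_prop))
      hderiv hbound hlim]
    simp [Real.sqrt_sq_eq_abs]
  rw [← integral_comp_polarCoord_symm]
  have hpolar (p : ℝ × ℝ) : p.1 • tiltedYukawa z a 0 0 (polarCoord.symm p) = g p.1 * 1 := by
    have : (p.1 * Real.cos p.2) ^ 2 + (p.1 * Real.sin p.2) ^ 2 = p.1 ^ 2 := by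
      linear_combination p.1 ^ 2 * Real.sin_sq_add_cos_sq p.2
    simp only [tiltedYukawa, polarCoord_symm_apply, this, hg, Complex.real_smul]
    simp [mul_div_assoc]
  simp only [hpolar]
  rw [polarCoord_target, Measure.volume_eq_prod,
    setIntegral_prod_mul g (fun _ ↦ (1 : ℂ)) (Set.Ioi 0) (Set.Ioo (-Real.pi) Real.pi), hint]
  simp [Real.pi_pos.le]
  ring

lemma differentiableOn_integral_tiltedYukawa (z : ℝ) (a : ℂ) (k₁ k₂ : ℝ) :
    DifferentiableOn ℂ (fun q : ℂ ↦ ∫ p, tiltedYukawa z a (q * k₁) (q * k₂) p)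
      {q | |q.re| * √(k₁ ^ 2 + k₂ ^ 2) < a.re} := by
  intro q₀ hq₀
  set K := √(k₁ ^ 2 + k₂ ^ 2) with hK
  have hsqrt (q : ℂ) : √((q * k₁).re ^ 2 + (q * k₂).re ^ 2) = |q.re| * K := by
    rw [Complex.re_mul_ofReal, Complex.re_mul_ofReal, mul_pow, mul_pow, ← mul_add,
      Real.sqrt_mul (sq_nonneg _), Real.sqrt_sq_eq_abs]
  obtain ⟨P, hP₀, hP⟩ := exists_between (show |q₀.re| * K < a.re from hq₀)
  have hs : {q : ℂ | |q.re| * K < P} ∈ nhds q₀ :=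
    (isOpen_lt (by fun_prop) continuous_const).mem_nhds hP₀
  have hd : 0 < a.re - P := by linarith
  have hbound (p : ℝ × ℝ) (q : ℂ) (hq : q ∈ {q : ℂ | |q.re| * K < P}) :
      ‖((k₁ * p.1 + k₂ * p.2 : ℝ) : ℂ) * tiltedYukawa z a (q * k₁) (q * k₂) p‖ ≤
        K * Real.exp (-(a.re - P) * ‖p‖) := by
    have hq' : |q.re| * K < P := hq
    have h1 := norm_tiltedYukawa_le (z := z) (d := a.re - P) (a := a) (b₁ := q * k₁)
      (b₂ := q * k₂) (by rw [hsqrt]; linarith) p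
    have h2 := abs_add_mul_le k₁ k₂ p z
    have h3 := norm_le_sqrt_add p z
    set R := √(p.1 ^ 2 + p.2 ^ 2 + z ^ 2)
    have hR : 0 ≤ R := Real.sqrt_nonneg _
    rw [norm_mul, Complex.norm_real, Real.norm_eq_abs]
    calc _ ≤ (K * R) * (Real.exp (-(a.re - P) * R) / R) := by gcongr
      _ = K * Real.exp (-(a.re - P) * R) * (R / R) := by ring
      _ ≤ K * Real.exp (-(a.re - P) * R) * 1 := by gcongr; exact div_self_le_one R
      _ ≤ K * Real.exp (-(a.re - P) * ‖p‖) := by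
        rw [mul_one]
        refine mul_le_mul_of_nonneg_left (Real.exp_le_exp.mpr ?_) (Real.sqrt_nonneg _)
        nlinarith
  have h := hasDerivAt_integral_of_dominated_loc_of_deriv_le (μ := (volume : Measure (ℝ × ℝ)))
    (F := fun (q : ℂ) p ↦ tiltedYukawa z a (q * k₁) (q * k₂) p)
    (F' := fun (q : ℂ) p ↦
      ((k₁ * p.1 + k₂ * p.2 : ℝ) : ℂ) * tiltedYukawa z a (q * k₁) (q * k₂) p)
    hs (Filter.Eventually.of_forall fun q ↦ (measurable_tiltedYukawa _ _ _ _).aestronglyMeasurable)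
    (integrable_tiltedYukawa z (by rw [hsqrt]; exact hq₀))
    (Measurable.aestronglyMeasurable
      (.mul (by fun_prop) (measurable_tiltedYukawa _ _ _ _)))
    (ae_of_all _ hbound) ((integrable_exp_neg_mul_norm hd).const_mul K)
    (ae_of_all _ fun p q _ ↦ ?_)
  · exact h.2.differentiableAt.differentiableWithinAt
  · have h1 : HasDerivAt (fun q : ℂ ↦ -a * (√(p.1 ^ 2 + p.2 ^ 2 + z ^ 2) : ℝ) +
        q * k₁ * p.1 + q * k₂ * p.2) (1 * k₁ * p.1 + 1 * k₂ * p.2) q :=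
      ((((hasDerivAt_id q).mul_const _).mul_const _).const_add _).add
        (((hasDerivAt_id q).mul_const _).mul_const _)
    refine (h1.cexp.div_const ((√(p.1 ^ 2 + p.2 ^ 2 + z ^ 2) : ℝ) : ℂ)).congr_deriv ?_
    simp only [tiltedYukawa]
    push_cast
    ring

lemma sq_sub_mem_slitPlane {a q : ℂ} {K : ℝ} (h : |q.re| * |K| < a.re) :
    a ^ 2 - q ^ 2 * (K : ℂ) ^ 2 ∈ Complex.slitPlane := by
  have heq : a ^ 2 - q ^ 2 * (K : ℂ) ^ 2 = (a - q * K) * (a + q * K) := by ring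
  rw [← abs_mul, abs_lt] at h
  rw [heq]
  apply mul_mem_slitPlane_of_re_pos
  · rw [Complex.sub_re, Complex.re_mul_ofReal]
    linarith
  · rw [Complex.add_re, Complex.re_mul_ofReal]
    linarith

/-- Two successive boosts remove a tilt proportional to the decay rate. -/
lemma integral_tiltedYukawa_real_mul (z : ℝ) {a : ℂ} (ha : 0 < a.re) (k₁ k₂ : ℝ) {l : ℝ}
    (hl : l ^ 2 * (k₁ ^ 2 + k₂ ^ 2) < 1) :
    ∫ p, tiltedYukawa z a (l * a * k₁) (l * a * k₂) p =
      2 * Real.pi * (Complex.exp (-(a ^ 2 - (l * a) ^ 2 * (√(k₁ ^ 2 + k₂ ^ 2) : ℝ) ^ 2) ^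
        ((1 : ℂ) / 2) * (|z| : ℝ)) /
        (a ^ 2 - (l * a) ^ 2 * (√(k₁ ^ 2 + k₂ ^ 2) : ℝ) ^ 2) ^ ((1 : ℂ) / 2)) := by
  have hpos₁ : 0 < 1 - (l * k₁) ^ 2 := by nlinarith [sq_nonneg (l * k₂)]
  set c₁ := √(1 - (l * k₁) ^ 2) with hc₁
  have hc₁pos : 0 < c₁ := Real.sqrt_pos.mpr hpos₁
  have hc₁sq : c₁ ^ 2 = 1 - (l * k₁) ^ 2 := Real.sq_sqrt hpos₁.le
  have hlt : (l * k₂) ^ 2 < c₁ ^ 2 := by rw [hc₁sq]; nlinarith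
  have hpos₂ : 0 < 1 - (l * k₂ / c₁) ^ 2 := by
    rw [div_pow, sub_pos, div_lt_one (by positivity)]
    exact hlt
  set c₂ := √(1 - (l * k₂ / c₁) ^ 2) with hc₂
  have hc₂pos : 0 < c₂ := Real.sqrt_pos.mpr hpos₂
  have hc₂sq : c₂ ^ 2 = 1 - (l * k₂ / c₁) ^ 2 := Real.sq_sqrt hpos₂.le
  have hprod : (c₁ * c₂) ^ 2 = 1 - l ^ 2 * (k₁ ^ 2 + k₂ ^ 2) := by
    rw [mul_pow, hc₂sq, div_pow, mul_sub, mul_div_cancel₀ _ (by positivity), hc₁sq]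
    ring
  have hc₁ne : (c₁ : ℂ) ≠ 0 := by exact_mod_cast hc₁pos.ne'
  have hre₁ : 0 < (c₁ * a).re := by rw [Complex.re_ofReal_mul]; positivity
  have hre₂ : 0 < (c₂ * (c₁ * a)).re := by rw [Complex.re_ofReal_mul]; positivity
  have e₁ : (l * a * k₁ : ℂ) = (l * k₁ : ℝ) * a := by push_cast; ring
  have e₂ : (l * a * k₂ : ℂ) = (l * k₂ / c₁ : ℝ) * (c₁ * a) := by
    push_cast
    field_simp
  have hb : |(l * a * k₂ : ℂ).re| < c₁ * a.re := by
    have : (l * a * k₂ : ℂ).re = l * k₂ * a.re := by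
      rw [Complex.re_mul_ofReal, Complex.re_ofReal_mul]
      ring
    rw [this, abs_mul, abs_of_pos ha]
    exact mul_lt_mul_of_pos_right (abs_lt_of_sq_lt_sq hlt hc₁pos.le) ha
  have hroot : (a ^ 2 - (l * a) ^ 2 * (√(k₁ ^ 2 + k₂ ^ 2) : ℝ) ^ 2) ^ ((1 : ℂ) / 2) =
      c₂ * (c₁ * a) := by
    refine eq_of_sq_eq_of_re_pos (half_cpow_re_pos (sq_sub_mem_slitPlane ?_)) hre₂ ?_
    · rw [Complex.re_ofReal_mul, abs_mul, abs_of_pos ha, mul_right_comm, ← abs_mul]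
      refine mul_lt_of_lt_one_left ha ?_
      refine abs_lt_of_sq_lt_sq ?_ zero_le_one
      rw [mul_pow, Real.sq_sqrt (by positivity)]
      simpa using hl
    · rw [half_cpow_sq, ← Complex.ofReal_pow, Real.sq_sqrt (by positivity)]
      have hprod' : ((c₁ : ℂ) * c₂) ^ 2 = 1 - l ^ 2 * (k₁ ^ 2 + k₂ ^ 2) := by exact_mod_cast hprod
      push_cast
      linear_combination -a ^ 2 * hprod'
  rw [hroot, e₁, integral_tiltedYukawa_boost z a _ hc₁pos (by rw [hc₁sq]; ring) ha hb,
    integral_tiltedYukawa_swap, e₂,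
    integral_tiltedYukawa_boost z (c₁ * a) 0 hc₂pos (by rw [hc₂sq]; ring) hre₁
      (by simpa using mul_pos hc₂pos hre₁),
    integral_tiltedYukawa_zero z hre₂]

lemma integral_tiltedYukawa (z : ℝ) {a : ℂ} (ha : 0 < a.re) (k₁ k₂ : ℝ) {q : ℂ}
    (hq : |q.re| * √(k₁ ^ 2 + k₂ ^ 2) < a.re) :
    ∫ p, tiltedYukawa z a (q * k₁) (q * k₂) p =
      2 * Real.pi * (Complex.exp (-(a ^ 2 - q ^ 2 * (√(k₁ ^ 2 + k₂ ^ 2) : ℝ) ^ 2) ^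
        ((1 : ℂ) / 2) * (|z| : ℝ)) /
        (a ^ 2 - q ^ 2 * (√(k₁ ^ 2 + k₂ ^ 2) : ℝ) ^ 2) ^ ((1 : ℂ) / 2)) := by
  set K := √(k₁ ^ 2 + k₂ ^ 2) with hK
  have hK0 : 0 ≤ K := Real.sqrt_nonneg _
  have ha0 : a ≠ 0 := by
    rintro rfl
    simp at ha
  have hopen : IsOpen {q : ℂ | |q.re| * K < a.re} := isOpen_lt (by fun_prop) continuous_const
  have hconv : Convex ℝ {q : ℂ | |q.re| * K < a.re} := by
    have h : ConvexOn ℝ Set.univ fun q : ℂ ↦ |q.re| * K := by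
      refine ⟨convex_univ, fun x _ y _ s t hs ht _ ↦ ?_⟩
      simp only [Complex.add_re, Complex.smul_re, smul_eq_mul]
      have := abs_add_le (s * x.re) (t * y.re)
      rw [abs_mul, abs_mul, abs_of_nonneg hs, abs_of_nonneg ht] at this
      nlinarith
    simpa using h.convex_lt a.re
  have hslit (q : ℂ) (hq : q ∈ {q : ℂ | |q.re| * K < a.re}) :
      a ^ 2 - q ^ 2 * (K : ℂ) ^ 2 ∈ Complex.slitPlane :=
    sq_sub_mem_slitPlane (by rwa [abs_of_nonneg hK0])
  have hroot : DifferentiableOn ℂ (fun q : ℂ ↦ (a ^ 2 - q ^ 2 * (K : ℂ) ^ 2) ^ ((1 : ℂ) / 2))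
      {q : ℂ | |q.re| * K < a.re} :=
    DifferentiableOn.cpow (by fun_prop) (by fun_prop) hslit
  have hroot0 (q : ℂ) (hq : q ∈ {q : ℂ | |q.re| * K < a.re}) :
      (a ^ 2 - q ^ 2 * (K : ℂ) ^ 2) ^ ((1 : ℂ) / 2) ≠ 0 := fun h ↦ by
    have := half_cpow_re_pos (hslit q hq)
    rw [h] at this
    exact lt_irrefl _ this
  have htend : Filter.Tendsto (fun l : ℝ ↦ (l : ℂ) * a) (nhdsWithin 0 {0}ᶜ)
      (nhdsWithin 0 {0}ᶜ) := by
    refine tendsto_nhdsWithin_iff.mpr ⟨?_, ?_⟩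
    · have : Continuous fun l : ℝ ↦ (l : ℂ) * a := by fun_prop
      simpa using (this.tendsto 0).mono_left nhdsWithin_le_nhds
    · filter_upwards [self_mem_nhdsWithin] with l hl
      simpa [ha0] using hl
  have hsmall : ∀ᶠ l : ℝ in nhdsWithin 0 {0}ᶜ, l ^ 2 * (k₁ ^ 2 + k₂ ^ 2) < 1 := by
    have : IsOpen {l : ℝ | l ^ 2 * (k₁ ^ 2 + k₂ ^ 2) < 1} :=
      isOpen_lt (by fun_prop) continuous_const
    exact nhdsWithin_le_nhds (this.mem_nhds (by simp))
  have hanalytic : DifferentiableOn ℂ (fun q : ℂ ↦ 2 * Real.pi *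
      (Complex.exp (-(a ^ 2 - q ^ 2 * (K : ℂ) ^ 2) ^ ((1 : ℂ) / 2) * (|z| : ℝ)) /
        (a ^ 2 - q ^ 2 * (K : ℂ) ^ 2) ^ ((1 : ℂ) / 2))) {q : ℂ | |q.re| * K < a.re} :=
    (((hroot.neg.mul_const _).cexp).div hroot hroot0).const_mul _
  exact AnalyticOnNhd.eqOn_of_preconnected_of_frequently_eq (z₀ := 0)
    ((differentiableOn_integral_tiltedYukawa z a k₁ k₂).analyticOnNhd hopen)
    (hanalytic.analyticOnNhd hopen) hconv.isPreconnected (by simpa using ha)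
    (htend.frequently (hsmall.mono fun l hl ↦
      integral_tiltedYukawa_real_mul z ha k₁ k₂ hl).frequently) hq

theorem stmt12 (k0 ε : ℝ) (hk0 : 0 < k0) (hε : 0 < ε) (r3 : ℝ) :
    -- κ_ε has positive imaginary part
    (∀ k1 k2 : ℝ, 0 < (kappaEps k0 ε k1 k2).im) ∧
    -- the slice (r1,r2) ↦ G_ε(r1,r2,r3) is integrable on ℝ²
    Integrable (fun p : ℝ × ℝ => GepsCoord k0 ε p.1 p.2 r3) volume ∧
    -- and its 2D Fourier transform is i e^{iκ_ε|r3|}/(4πκ_ε)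
    ∀ k1 k2 : ℝ,
      ((2 * Real.pi : ℝ) : ℂ)⁻¹ *
          ∫ p : ℝ × ℝ, GepsCoord k0 ε p.1 p.2 r3 *
            Complex.exp (-Complex.I * ((k1 * p.1 + k2 * p.2 : ℝ) : ℂ)) =
        Complex.I * Complex.exp (Complex.I * kappaEps k0 ε k1 k2 * ((|r3| : ℝ) : ℂ)) /
          (4 * (Real.pi : ℂ) * kappaEps k0 ε k1 k2) := by
  have him (k1 k2 : ℝ) : 0 < (kappaEps k0 ε k1 k2).im := by
    refine half_cpow_im_pos ?_
    have : (((k0 : ℂ) + Complex.I * (ε : ℂ)) ^ 2 - (k1 : ℂ) ^ 2 - (k2 : ℂ) ^ 2).im =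
        2 * (k0 * ε) := by
      simp [sq]
      ring
    rw [this]
    positivity
  set a : ℂ := (ε : ℂ) - Complex.I * k0 with ha
  have hre : a.re = ε := by simp [ha]
  have hG (k1 k2 : ℝ) (p : ℝ × ℝ) : GepsCoord k0 ε p.1 p.2 r3 *
      Complex.exp (-Complex.I * ((k1 * p.1 + k2 * p.2 : ℝ) : ℂ)) =
      (4 * (Real.pi : ℂ))⁻¹ * tiltedYukawa r3 a (-Complex.I * k1) (-Complex.I * k2) p := by
    have hexp : -a * (√(p.1 ^ 2 + p.2 ^ 2 + r3 ^ 2) : ℝ) + -Complex.I * k1 * p.1 +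
        -Complex.I * k2 * p.2 =
        (Complex.I * (k0 : ℂ) - (ε : ℂ)) * (√(p.1 ^ 2 + p.2 ^ 2 + r3 ^ 2) : ℝ) +
          -Complex.I * ((k1 * p.1 + k2 * p.2 : ℝ) : ℂ) := by
      simp only [ha]
      push_cast
      ring
    rw [GepsCoord, tiltedYukawa, hexp, Complex.exp_add, mul_comm (4 * (Real.pi : ℂ)),
      ← div_div]
    ring
  refine ⟨him, ?_, fun k1 k2 ↦ ?_⟩
  · have h : Integrable (tiltedYukawa r3 a (-Complex.I * (0 : ℝ)) (-Complex.I * (0 : ℝ))) :=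
      integrable_tiltedYukawa r3 (by simpa [hre] using hε)
    refine (h.const_mul (4 * (Real.pi : ℂ))⁻¹).congr (ae_of_all _ fun p ↦ ?_)
    simp only [← hG]
    simp
  · have hroot : (a ^ 2 - (-Complex.I) ^ 2 * (√(k1 ^ 2 + k2 ^ 2) : ℝ) ^ 2) ^ ((1 : ℂ) / 2) =
        -Complex.I * kappaEps k0 ε k1 k2 := by
      refine eq_of_sq_eq_of_re_pos (half_cpow_re_pos (sq_sub_mem_slitPlane ?_)) ?_ ?_
      · simpa [hre] using hε
      · simpa using him k1 k2
      · rw [half_cpow_sq, mul_pow, kappaEps, half_cpow_sq, ← Complex.ofReal_pow,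
          Real.sq_sqrt (by positivity)]
        simp only [ha]
        push_cast
        linear_combination (ε ^ 2 - Complex.I ^ 2 * ε ^ 2 - 2 * Complex.I * k0 * ε) *
          Complex.I_sq
    have hκ : kappaEps k0 ε k1 k2 ≠ 0 := fun h ↦ by
      have := him k1 k2
      simp [h] at this
    simp only [hG]
    rw [integral_const_mul, integral_tiltedYukawa r3 (hre ▸ hε) k1 k2 (by simpa [hre] using hε),
      hroot]
    have hπ : (Real.pi : ℂ) ≠ 0 := by exact_mod_cast Real.pi_ne_zero
    have hI := Complex.I_ne_zero
    rw [show -(-Complex.I * kappaEps k0 ε k1 k2) = Complex.I * kappaEps k0 ε k1 k2 by ring]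
    push_cast
    field_simp
    rw [Complex.I_sq]
end
end

section
/- Let k0>0, r>0, and let g:ℝ³→ℂ be continuous with support contained in the open ball B_r of radius r centered at the origin. Define u(x) = ∫_{ℝ³} e^{i k0 ‖x−y‖}/(4π‖x−y‖) · g(y) dy (the outgoing solution of Δu + k0²u = −g). Then, for every r_M > r and all (r1,r2)∈ℝ², u(r1,r2,r_M) = (i/(2√(2π))) ∫_{ℝ²} κ(k1,k2)^{−1} e^{i(k1r1 + k2r2 + κ(k1,k2)·r_M)} 𝓕g(k1,k2,κ(k1,k2)) d(k1,k2), where 𝓕g(k1,k2,κ) = (2π)^{−3/2}∫_{ℝ³} g(x)e^{−i(k1x1+k2x2+κx3)}dx (well defined for complex κ since g is compactly supported), the integrand is absolutely integrable over ℝ², and κ is as defined below. -/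
open MeasureTheory

noncomputable section

/-- κ(k1,k2) = √(k0²−k1²−k2²) for k1²+k2² ≤ k0², and i√(k1²+k2²−k0²) otherwise. -/
def kappaC (k0 k1 k2 : ℝ) : ℂ :=
  if k1 ^ 2 + k2 ^ 2 ≤ k0 ^ 2 then ((Real.sqrt (k0 ^ 2 - k1 ^ 2 - k2 ^ 2) : ℝ) : ℂ)
  else Complex.I * ((Real.sqrt (k1 ^ 2 + k2 ^ 2 - k0 ^ 2) : ℝ) : ℂ)

/-- The 3D Fourier transform 𝓕g(k1,k2,w) = (2π)^{−3/2} ∫ g(x) e^{−i(k1x1+k2x2+wx3)} dx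
with possibly complex third frequency `w`. -/
def FT3c (g : ℝ × ℝ × ℝ → ℂ) (k1 k2 : ℝ) (w : ℂ) : ℂ :=
  (((2 * Real.pi) ^ (-(3 : ℝ) / 2) : ℝ) : ℂ) *
    ∫ x : ℝ × ℝ × ℝ, g x *
      Complex.exp (-Complex.I * ((k1 : ℂ) * (x.1 : ℂ) + (k2 : ℂ) * (x.2.1 : ℂ) + w * (x.2.2 : ℂ)))

/-- The outgoing solution u = G ∗ g of Δu + k0²u = −g. -/
def uSol (k0 : ℝ) (g : ℝ × ℝ × ℝ → ℂ) (x : ℝ × ℝ × ℝ) : ℂ :=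
  ∫ y : ℝ × ℝ × ℝ,
    Complex.exp (Complex.I * (k0 : ℂ) *
        ((Real.sqrt ((x.1 - y.1) ^ 2 + (x.2.1 - y.2.1) ^ 2 + (x.2.2 - y.2.2) ^ 2) : ℝ) : ℂ)) /
      (4 * (Real.pi : ℂ) *
        ((Real.sqrt ((x.1 - y.1) ^ 2 + (x.2.1 - y.2.1) ^ 2 + (x.2.2 - y.2.2) ^ 2) : ℝ) : ℂ)) *
      g y

section
open Set Real

lemma hasDerivAt_mul_sub_div (a b : ℝ) {u : ℝ} (hu : u ≠ 0) :
    HasDerivAt (fun u : ℝ => a * u - b / u) (a + b / u ^ 2) u := by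
  have h := ((hasDerivAt_id u).const_mul a).sub ((hasDerivAt_inv hu).const_mul b)
  convert! h using 1
  field_simp
  ring

lemma hasDerivAt_const_div (c : ℝ) {u : ℝ} (hu : u ≠ 0) :
    HasDerivAt (fun u : ℝ => c / u) (-(c / u ^ 2)) u := by
  have h := (hasDerivAt_inv hu).const_mul c
  convert! h using 1
  ring

lemma injOn_mul_sub_div {a b : ℝ} (ha : 0 < a) (hb : 0 < b) :
    InjOn (fun u : ℝ => a * u - b / u) (Ioi 0) := by
  intro x (hx : 0 < x) y (hy : 0 < y) h
  have h' : a * x - b / x = a * y - b / y := h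
  have : (x - y) * (a + b / (x * y)) = 0 := by
    have e : (x - y) * (a + b / (x * y)) = (a * x - b / x) - (a * y - b / y) := by
      field_simp
      ring
    rw [e, h', sub_self]
  have h2 : a + b / (x * y) ≠ 0 := by positivity
  linarith [(mul_eq_zero.1 this).resolve_right h2]

lemma image_mul_sub_div {a b : ℝ} (ha : 0 < a) (hb : 0 < b) :
    (fun u : ℝ => a * u - b / u) '' Ioi 0 = univ := by
  refine eq_univ_of_forall fun v => ?_
  have h1 : √(v ^ 2 + 4 * a * b) ^ 2 = v ^ 2 + 4 * a * b := sq_sqrt (by positivity)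
  have h2 : |v| < √(v ^ 2 + 4 * a * b) := by
    apply lt_sqrt_of_sq_lt
    rw [sq_abs]
    have : 0 < a * b := by positivity
    linarith
  have h3 : 0 < v + √(v ^ 2 + 4 * a * b) := by linarith [neg_abs_le v]
  generalize √(v ^ 2 + 4 * a * b) = w at *
  refine ⟨(v + w) / (2 * a), by simp only [mem_Ioi]; positivity, ?_⟩
  field_simp
  nlinarith

lemma image_const_div {c : ℝ} (hc : 0 < c) :
    (fun u : ℝ => c / u) '' Ioi 0 = Ioi 0 := by
  ext v
  constructor
  · rintro ⟨u, hu : 0 < u, rfl⟩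
    exact div_pos hc hu
  · intro (hv : 0 < v)
    exact ⟨c / v, div_pos hc hv, by field_simp⟩

/-- The Cauchy–Schlömilch substitution applied to a Gaussian. -/
lemma integral_inv_sq_mul_gaussian_sub_div {a b : ℝ} (ha : 0 < a) (hb : 0 < b) :
    IntegrableOn (fun u : ℝ => exp (-(a * u - b / u) ^ 2)) (Ioi 0) ∧
    (∫ u in Ioi (0 : ℝ), exp (-(a * u - b / u) ^ 2) = √π / (2 * a)) ∧
    (∫ u in Ioi (0 : ℝ), (u ^ 2)⁻¹ * exp (-(a * u - b / u) ^ 2) = √π / (2 * b)) := by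
  set E : ℝ → ℝ := fun u => exp (-(a * u - b / u) ^ 2) with hE
  have hder : ∀ u ∈ Ioi (0 : ℝ),
      HasDerivWithinAt (fun u : ℝ => a * u - b / u) (a + b / u ^ 2) (Ioi 0) u :=
    fun u hu => (hasDerivAt_mul_sub_div a b (ne_of_gt hu)).hasDerivWithinAt
  have hgi : Integrable (fun v : ℝ => exp (-v ^ 2)) := by
    simpa using integrable_exp_neg_mul_sq (b := 1) one_pos
  have hI : IntegrableOn (fun u : ℝ => (a + b / u ^ 2) * E u) (Ioi 0) := by
    have h := (integrableOn_image_iff_integrableOn_abs_deriv_smul measurableSet_Ioi hder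
      (injOn_mul_sub_div ha hb) (fun v => exp (-v ^ 2))).1 hgi.integrableOn
    refine h.congr_fun (fun u hu => ?_) measurableSet_Ioi
    have : 0 < a + b / u ^ 2 := by positivity
    simp only [smul_eq_mul, abs_of_pos this, hE]
  have hS : ∫ u in Ioi (0 : ℝ), (a + b / u ^ 2) * E u = √π := by
    have h := integral_image_eq_integral_abs_deriv_smul measurableSet_Ioi hder
      (injOn_mul_sub_div ha hb) (fun v => exp (-v ^ 2))
    rw [image_mul_sub_div ha hb, setIntegral_univ] at h
    have h2 := integral_gaussian 1
    simp only [neg_mul, one_mul, div_one] at h2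
    rw [← h2, h]
    refine setIntegral_congr_fun measurableSet_Ioi (fun u hu => ?_)
    have : 0 < a + b / u ^ 2 := by positivity
    simp only [smul_eq_mul, abs_of_pos this, hE]
  have hEc : ContinuousOn E (Ioi 0) := by
    intro u hu
    exact ((hasDerivAt_mul_sub_div a b (ne_of_gt hu)).continuousAt.pow 2).neg.rexp.continuousWithinAt
  have hEm := hEc.aestronglyMeasurable (μ := volume) measurableSet_Ioi
  have hEi : IntegrableOn E (Ioi 0) := by
    refine (hI.const_mul a⁻¹).mono' hEm ?_
    filter_upwards [ae_restrict_mem measurableSet_Ioi] with u hu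
    have h0 : 0 < E u := exp_pos _
    rw [norm_of_nonneg h0.le, ← mul_assoc]
    refine le_mul_of_one_le_left h0.le ?_
    rw [mul_add, inv_mul_cancel₀ ha.ne']
    have : 0 ≤ a⁻¹ * (b / u ^ 2) := by positivity
    linarith
  have hEi2 : IntegrableOn (fun u => (u ^ 2)⁻¹ * E u) (Ioi 0) := by
    have h : IntegrableOn (fun u => b⁻¹ * ((a + b / u ^ 2) * E u - a * E u)) (Ioi 0) :=
      (hI.sub (hEi.const_mul a)).const_mul b⁻¹
    refine h.congr_fun (fun u hu => ?_) measurableSet_Ioi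
    have hu : u ≠ 0 := ne_of_gt hu
    field_simp
    ring
  have hsplit : a * (∫ u in Ioi (0 : ℝ), E u) + b * (∫ u in Ioi (0 : ℝ), (u ^ 2)⁻¹ * E u) = √π := by
    rw [← integral_const_mul, ← integral_const_mul, ← integral_add (hEi.const_mul a)
      (hEi2.const_mul b), ← hS]
    congr 1
    ext u
    ring
  have hc : 0 < b / a := by positivity
  have hswap : (∫ u in Ioi (0 : ℝ), E u) = b / a * ∫ u in Ioi (0 : ℝ), (u ^ 2)⁻¹ * E u := by
    have h := integral_image_eq_integral_abs_deriv_smul measurableSet_Ioi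
      (fun u hu => (hasDerivAt_const_div (b / a) (ne_of_gt hu)).hasDerivWithinAt)
      (fun x (hx : 0 < x) y (hy : 0 < y) (h : b / a / x = b / a / y) => by
        field_simp at h; exact h.symm) E
    rw [image_const_div hc] at h
    rw [h, ← integral_const_mul]
    refine setIntegral_congr_fun measurableSet_Ioi (fun u (hu : 0 < u) => ?_)
    have e : a * (b / a / u) - b / (b / a / u) = -(a * u - b / u) := by
      field_simp
      ring
    have : 0 < b / a / u ^ 2 := by positivity
    simp only [smul_eq_mul, hE, abs_neg, abs_of_pos this, e, neg_sq]
    ring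
  rw [hswap] at hsplit ⊢
  have hB : ∫ u in Ioi (0 : ℝ), (u ^ 2)⁻¹ * E u = √π / (2 * b) := by
    rw [← hsplit]
    generalize ∫ u in Ioi (0 : ℝ), (u ^ 2)⁻¹ * E u = B
    field_simp
    ring
  refine ⟨hEi, ?_, hB⟩
  rw [hB]
  field_simp

/-- `∫₀^∞ exp(-a²u² - b²/u²) du` and its variant with the weight `u⁻²`. -/
lemma integral_exp_neg_sq_add_inv_sq {a b : ℝ} (ha : 0 < a) (hb : 0 < b) :
    IntegrableOn (fun u : ℝ => exp (-(a ^ 2 * u ^ 2 + b ^ 2 / u ^ 2))) (Ioi 0) ∧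
    (∫ u in Ioi (0 : ℝ), exp (-(a ^ 2 * u ^ 2 + b ^ 2 / u ^ 2)) =
      √π / (2 * a) * exp (-(2 * a * b))) ∧
    (∫ u in Ioi (0 : ℝ), (u ^ 2)⁻¹ * exp (-(a ^ 2 * u ^ 2 + b ^ 2 / u ^ 2)) =
      √π / (2 * b) * exp (-(2 * a * b))) := by
  obtain ⟨h1, h2, h3⟩ := integral_inv_sq_mul_gaussian_sub_div ha hb
  have key : ∀ u ∈ Ioi (0 : ℝ), exp (-(a ^ 2 * u ^ 2 + b ^ 2 / u ^ 2)) =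
      exp (-(a * u - b / u) ^ 2) * exp (-(2 * a * b)) := by
    intro u hu
    have hu : u ≠ 0 := ne_of_gt hu
    rw [← exp_add]
    congr 1
    field_simp
    ring
  have h1' : IntegrableOn (fun u => exp (-(a * u - b / u) ^ 2) * exp (-(2 * a * b))) (Ioi 0) :=
    h1.mul_const _
  refine ⟨h1'.congr_fun (fun u hu => (key u hu).symm) measurableSet_Ioi, ?_, ?_⟩
  · rw [setIntegral_congr_fun measurableSet_Ioi key, integral_mul_const, h2]
  · rw [← h3, ← integral_mul_const]
    refine setIntegral_congr_fun measurableSet_Ioi fun u hu => ?_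
    simp only [key u hu, mul_assoc]
end

section
open Set Real Filter Topology

/-- A radial majorant of the integrands in the plane-wave representations below, with the radial
variable squared equal to `p.1 ^ 2 + p.2 ^ 2`; note that `√` vanishes on negative reals. -/
def weylBound (z c : ℝ) (p : ℝ × ℝ) : ℝ :=
  exp (-(z * √(p.1 ^ 2 + p.2 ^ 2 + c))) / √|p.1 ^ 2 + p.2 ^ 2 + c|

lemma ae_sq_add_sq_ne (c : ℝ) : ∀ᵐ p : ℝ × ℝ, p.1 ^ 2 + p.2 ^ 2 ≠ c := by
  rw [ae_iff]
  simp only [ne_eq, not_not]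
  refine (Measure.measure_prod_null ?_).2 (ae_of_all _ fun x => ?_)
  · exact (isClosed_eq (by fun_prop) (by fun_prop)).measurableSet
  · refine Set.Finite.measure_zero ?_ _
    refine (Set.toFinite {√(c - x ^ 2), -√(c - x ^ 2)}).subset fun y hy => ?_
    have hy : x ^ 2 + y ^ 2 = c := hy
    have e : √(c - x ^ 2) = |y| := by
      rw [← hy, add_sub_cancel_left, sqrt_sq_eq_abs]
    rw [e]
    rcases abs_choice y with h | h <;> simp [h]

lemma integrable_comp_sqrt_add_sq {f : ℝ → ℝ} (h : IntegrableOn (fun y : ℝ => y * f y) (Ioi 0)) :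
    Integrable (fun p : ℝ × ℝ => f √(p.1 ^ 2 + p.2 ^ 2)) := by
  have h1 : Integrable (fun w : ℂ => f ‖w‖) := by
    rw [integrable_fun_norm_addHaar volume (f := f)]
    simpa [Complex.finrank_real_complex] using h
  have h2 := (Complex.volume_preserving_equiv_real_prod.symm).integrable_comp_emb
    Complex.measurableEquivRealProd.symm.measurableEmbedding (g := fun w : ℂ => f ‖w‖)
  refine (h2.2 h1).congr (ae_of_all _ fun p => ?_)
  simp only [Function.comp_apply]
  congr 1
  rw [Complex.norm_eq_sqrt_sq_add_sq]
  rfl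

lemma integrableOn_radial_weylBound {z k : ℝ} (hz : 0 < z) (hk : 0 ≤ k) :
    IntegrableOn (fun y : ℝ => y * (exp (-(z * √(y ^ 2 - k ^ 2))) / √|y ^ 2 - k ^ 2|)) (Ioi 0) := by
  have h1 : IntegrableOn (fun y : ℝ => y * (exp (-(z * √(y ^ 2 - k ^ 2))) / √|y ^ 2 - k ^ 2|))
      (Ioc 0 k) := by
    refine intervalIntegral.integrableOn_deriv_of_nonneg (g := fun y => -√(k ^ 2 - y ^ 2))
      (by fun_prop) ?_ ?_
    · intro y ⟨hy0, hyk⟩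
      have hpos : 0 < k ^ 2 - y ^ 2 := by nlinarith
      have hd : HasDerivAt (fun y : ℝ => k ^ 2 - y ^ 2) (-(2 * y)) y := by
        simpa using ((hasDerivAt_id y).pow 2).const_sub (k ^ 2)
      convert! (hd.sqrt hpos.ne').neg using 1
      have e : √(y ^ 2 - k ^ 2) = 0 := sqrt_eq_zero_of_nonpos (by linarith)
      rw [e, abs_of_neg (by linarith : y ^ 2 - k ^ 2 < 0), neg_sub]
      have := sqrt_pos.2 hpos
      simp
      field_simp
    · intro y ⟨hy0, hyk⟩
      positivity
  have h2 : IntegrableOn (fun y : ℝ => y * (exp (-(z * √(y ^ 2 - k ^ 2))) / √|y ^ 2 - k ^ 2|))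
      (Ioi k) := by
    refine integrableOn_Ioi_deriv_of_nonneg
      (g := fun y => -(exp (-(z * √(y ^ 2 - k ^ 2))) / z)) (l := 0)
      (by fun_prop) ?_ ?_ ?_
    · intro y (hy : k < y)
      have hpos : 0 < y ^ 2 - k ^ 2 := by nlinarith
      have hd : HasDerivAt (fun y : ℝ => y ^ 2 - k ^ 2) (2 * y) y := by
        simpa using ((hasDerivAt_id y).pow 2).sub_const (k ^ 2)
      convert! ((((hd.sqrt hpos.ne').const_mul z).neg.exp).div_const z).neg using 1
      rw [abs_of_pos hpos]
      have := sqrt_pos.2 hpos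
      field_simp
      simp only [Pi.neg_apply]
    · intro y (hy : k < y)
      have : 0 < y := hk.trans_lt hy
      positivity
    · have hsq : Tendsto (fun y : ℝ => √(y ^ 2 - k ^ 2)) atTop atTop :=
        tendsto_sqrt_atTop.comp
          (tendsto_atTop_add_const_right _ _ (tendsto_pow_atTop two_ne_zero))
      have := ((tendsto_exp_atBot.comp
        (tendsto_neg_atTop_atBot.comp (hsq.const_mul_atTop hz))).div_const z).neg
      simpa using this
  have : Ioi (0 : ℝ) = Ioc 0 k ∪ Ioi k := (Ioc_union_Ioi_eq_Ioi hk).symm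
  rw [this]
  exact h1.union h2

lemma integrable_weylBound_neg_sq {z : ℝ} (hz : 0 < z) (k : ℝ) :
    Integrable (weylBound z (-k ^ 2)) := by
  have h := integrable_comp_sqrt_add_sq (integrableOn_radial_weylBound hz (abs_nonneg k))
  refine h.congr (ae_of_all _ fun p => ?_)
  have h2 : √(p.1 ^ 2 + p.2 ^ 2) ^ 2 = p.1 ^ 2 + p.2 ^ 2 := sq_sqrt (by positivity)
  simp only [h2, weylBound, sq_abs, sub_eq_add_neg]

lemma integrable_exp_neg_mul_sqrt {z : ℝ} (hz : 0 < z) (k : ℝ) :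
    Integrable (fun p : ℝ × ℝ => exp (-(z * √(p.1 ^ 2 + p.2 ^ 2 - k ^ 2)))) := by
  have h := (integrable_weylBound_neg_sq (half_pos hz) k).const_mul (|k| + 2 / z)
  refine h.mono' (by fun_prop) ?_
  filter_upwards [ae_sq_add_sq_ne (k ^ 2)] with p hp
  have hpos : 0 < √|p.1 ^ 2 + p.2 ^ 2 + -k ^ 2| :=
    sqrt_pos.2 (abs_pos.2 fun h => hp (by linarith))
  rw [norm_of_nonneg (exp_pos _).le, weylBound, ← mul_div_assoc, le_div_iff₀ hpos]
  have e : exp (-(z * √(p.1 ^ 2 + p.2 ^ 2 - k ^ 2))) =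
      exp (-(z / 2 * √(p.1 ^ 2 + p.2 ^ 2 + -k ^ 2))) *
      exp (-(z / 2 * √(p.1 ^ 2 + p.2 ^ 2 + -k ^ 2))) := by
    rw [← exp_add, sub_eq_add_neg]
    congr 1
    ring
  rw [e, mul_comm (|k| + 2 / z), mul_assoc]
  gcongr
  rcases le_total 0 (p.1 ^ 2 + p.2 ^ 2 + -k ^ 2) with h0 | h0
  · rw [abs_of_nonneg h0]
    generalize √(p.1 ^ 2 + p.2 ^ 2 + -k ^ 2) = s
    have h1 := add_one_le_exp (z / 2 * s)
    rw [exp_neg, inv_mul_le_iff₀ (exp_pos _)]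
    calc s = z / 2 * s * (2 / z) := by field_simp
      _ ≤ exp (z / 2 * s) * (|k| + 2 / z) := by
        gcongr
        · linarith
        · linarith [abs_nonneg k]
  · rw [sqrt_eq_zero_of_nonpos h0]
    simp only [mul_zero, neg_zero, exp_zero, one_mul]
    have : √|p.1 ^ 2 + p.2 ^ 2 + -k ^ 2| ≤ |k| := by
      rw [abs_of_nonpos h0]
      refine sqrt_le_iff.2 ⟨abs_nonneg _, ?_⟩
      rw [sq_abs]
      nlinarith [sq_nonneg p.1, sq_nonneg p.2]
    have : 0 < 2 / z := by positivity
    linarith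

lemma weylBound_antitone_left {z₁ z₂ c : ℝ} (h : z₁ ≤ z₂) (p : ℝ × ℝ) :
    weylBound z₂ c p ≤ weylBound z₁ c p := by
  unfold weylBound
  gcongr

lemma weylBound_le_of_nonneg {z c : ℝ} (hz : 0 < z) (hc : 0 ≤ c) (p : ℝ × ℝ)
    (hp : p.1 ^ 2 + p.2 ^ 2 ≠ 0) : weylBound z c p ≤ weylBound z 0 p := by
  unfold weylBound
  have h0 : 0 < p.1 ^ 2 + p.2 ^ 2 := lt_of_le_of_ne (by positivity) hp.symm
  rw [abs_of_pos (by linarith), abs_of_pos (by linarith)]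
  have : 0 < √(p.1 ^ 2 + p.2 ^ 2 + 0) := sqrt_pos.2 (by linarith)
  gcongr

lemma measurable_weylBound (z c : ℝ) : Measurable (weylBound z c) := by
  unfold weylBound
  fun_prop

lemma weylBound_nonneg (z c : ℝ) (p : ℝ × ℝ) : 0 ≤ weylBound z c p := by
  unfold weylBound
  positivity

lemma integrable_weylBound {z : ℝ} (hz : 0 < z) (c : ℝ) : Integrable (weylBound z c) := by
  rcases le_total c 0 with h | h
  · have := integrable_weylBound_neg_sq hz √(-c)
    rwa [sq_sqrt (by linarith), neg_neg] at this
  · have h0 : Integrable (weylBound z 0) := by simpa using integrable_weylBound_neg_sq hz 0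
    refine h0.mono' (measurable_weylBound z c).aestronglyMeasurable ?_
    filter_upwards [ae_sq_add_sq_ne 0] with p hp
    rw [norm_of_nonneg (weylBound_nonneg z c p)]
    exact weylBound_le_of_nonneg hz h p hp
end

section
open Set Real Filter Topology

/-- The plane-wave integrand with spectral parameter `s`; for `s = -k₀²` (approached from the lower
half plane) this is the integrand of the Weyl representation of the outgoing fundamental
solution. -/
def weylKernel (z x1 x2 : ℝ) (s : ℂ) (p : ℝ × ℝ) : ℂ :=
  Complex.exp (Complex.I * ((p.1 * x1 + p.2 * x2 : ℝ) : ℂ)) *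
    (Complex.exp (-(z * Complex.sqrt (((p.1 ^ 2 + p.2 ^ 2 : ℝ) : ℂ) + s))) /
      Complex.sqrt (((p.1 ^ 2 + p.2 ^ 2 : ℝ) : ℂ) + s))

lemma complex_sqrt_sq (q : ℂ) : Complex.sqrt q ^ 2 = q := by
  simp [Complex.sqrt]

lemma norm_complex_sqrt (q : ℂ) : ‖Complex.sqrt q‖ = √‖q‖ := by
  rw [eq_comm, sqrt_eq_iff_eq_sq (norm_nonneg _) (norm_nonneg _), ← norm_pow, complex_sqrt_sq]

lemma sqrt_re_le_re_complex_sqrt (q : ℂ) : √q.re ≤ (Complex.sqrt q).re := by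
  rw [Complex.sqrt, Complex.cpow_inv_two_re]
  gcongr
  linarith [Complex.re_le_norm q]

lemma hasDerivAt_complex_sqrt {q : ℂ} (hq : q ∈ Complex.slitPlane) :
    HasDerivAt Complex.sqrt (1 / (2 * Complex.sqrt q)) q := by
  have h := (hasDerivAt_id q).cpow_const (c := (2⁻¹ : ℂ)) hq
  have h0 : q ≠ 0 := Complex.slitPlane_ne_zero hq
  convert! h using 1
  have e : (2⁻¹ : ℂ) - 1 = -2⁻¹ := by norm_num
  simp only [id, e, Complex.cpow_neg, Complex.sqrt]
  field_simp

lemma measurable_complex_sqrt : Measurable Complex.sqrt := by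
  unfold Complex.sqrt
  fun_prop

lemma measurable_weylKernel (z x1 x2 : ℝ) (s : ℂ) : Measurable (weylKernel z x1 x2 s) := by
  have := measurable_complex_sqrt
  unfold weylKernel
  fun_prop

lemma norm_exp_I_mul_ofReal_eq_one (t : ℝ) : ‖Complex.exp (Complex.I * (t : ℂ))‖ = 1 := by
  rw [mul_comm, Complex.norm_exp_ofReal_mul_I]

lemma norm_exp_neg_mul_sqrt_le {z : ℝ} (hz : 0 < z) (q : ℂ) :
    ‖Complex.exp (-(z * Complex.sqrt q))‖ ≤ exp (-(z * √q.re)) := by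
  rw [Complex.norm_exp, Complex.neg_re, Complex.re_ofReal_mul]
  gcongr
  exact sqrt_re_le_re_complex_sqrt q

lemma norm_weylKernel_le {z : ℝ} (hz : 0 < z) (x1 x2 : ℝ) (s : ℂ) {p : ℝ × ℝ}
    (hp : p.1 ^ 2 + p.2 ^ 2 + s.re ≠ 0) :
    ‖weylKernel z x1 x2 s p‖ ≤ weylBound z s.re p := by
  have h1 := norm_exp_neg_mul_sqrt_le hz (((p.1 ^ 2 + p.2 ^ 2 : ℝ) : ℂ) + s)
  rw [weylKernel, norm_mul, norm_exp_I_mul_ofReal_eq_one, one_mul, norm_div, norm_complex_sqrt,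
    weylBound]
  have h2 := Complex.abs_re_le_norm (((p.1 ^ 2 + p.2 ^ 2 : ℝ) : ℂ) + s)
  simp only [Complex.add_re, Complex.ofReal_re] at h1 h2
  have h3 : 0 < √|p.1 ^ 2 + p.2 ^ 2 + s.re| := sqrt_pos.2 (abs_pos.2 hp)
  gcongr

lemma integrable_weylKernel {z : ℝ} (hz : 0 < z) (x1 x2 : ℝ) (s : ℂ) :
    Integrable (weylKernel z x1 x2 s) := by
  refine (integrable_weylBound hz s.re).mono'
    (measurable_weylKernel z x1 x2 s).aestronglyMeasurable ?_
  filter_upwards [ae_sq_add_sq_ne (-s.re)] with p hp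
  exact norm_weylKernel_le hz x1 x2 s fun h => hp (by linarith)

lemma weylKernel_eq_of_pos (z x1 x2 : ℝ) {a : ℝ} (ha : 0 < a) (p : ℝ × ℝ) :
    weylKernel z x1 x2 ((a ^ 2 : ℝ) : ℂ) p =
      Complex.exp (Complex.I * ((p.1 * x1 + p.2 * x2 : ℝ) : ℂ)) *
        ((exp (-(z * √(p.1 ^ 2 + p.2 ^ 2 + a ^ 2))) / √(p.1 ^ 2 + p.2 ^ 2 + a ^ 2) : ℝ) : ℂ) := by
  have h : Complex.sqrt (((p.1 ^ 2 + p.2 ^ 2 : ℝ) : ℂ) + ((a ^ 2 : ℝ) : ℂ)) =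
      ((√(p.1 ^ 2 + p.2 ^ 2 + a ^ 2) : ℝ) : ℂ) := by
    rw [← Complex.ofReal_add, Complex.sqrt_of_nonneg (by
      rw [Complex.zero_le_real]; positivity), Complex.ofReal_re]
  rw [weylKernel, h]
  push_cast
  rfl

lemma integral_exp_I_mul_gaussian {u : ℝ} (hu : 0 < u) (x1 x2 : ℝ) :
    ∫ p : ℝ × ℝ, Complex.exp (Complex.I * ((p.1 * x1 + p.2 * x2 : ℝ) : ℂ)) *
      ((exp (-((p.1 ^ 2 + p.2 ^ 2) * u ^ 2)) : ℝ) : ℂ) =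
      ((π / u ^ 2 * exp (-((x1 ^ 2 + x2 ^ 2) / 4 / u ^ 2)) : ℝ) : ℂ) := by
  have hb : 0 < ((u : ℂ) ^ 2).re := by
    rw [← Complex.ofReal_pow, Complex.ofReal_re]
    positivity
  have hu' : (u : ℂ) ≠ 0 := by exact_mod_cast hu.ne'
  have h1 := fourierIntegral_gaussian hb (x1 : ℂ)
  have h2 := fourierIntegral_gaussian hb (x2 : ℂ)
  have h := integral_prod_mul (μ := (volume : Measure ℝ)) (ν := (volume : Measure ℝ))
    (fun p : ℝ => Complex.exp (Complex.I * x1 * p) * Complex.exp (-(u : ℂ) ^ 2 * p ^ 2))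
    (fun p : ℝ => Complex.exp (Complex.I * x2 * p) * Complex.exp (-(u : ℂ) ^ 2 * p ^ 2))
  rw [h1, h2] at h
  have e : ((π : ℂ) / (u : ℂ) ^ 2) ^ (1 / 2 : ℂ) * ((π : ℂ) / (u : ℂ) ^ 2) ^ (1 / 2 : ℂ) =
      (π : ℂ) / (u : ℂ) ^ 2 := by
    rw [← sq, one_div, Complex.cpow_ofNat_inv_pow]
  rw [mul_mul_mul_comm, e, ← Complex.exp_add] at h
  convert! h using 1
  · congr 1
    ext p
    push_cast
    simp only [← Complex.exp_add]
    congr 1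
    ring
  · push_cast
    congr 2
    field_simp
    ring

lemma integral_weylKernel_of_pos {z a : ℝ} (hz : 0 < z) (ha : 0 < a) (x1 x2 : ℝ) :
    ∫ p, weylKernel z x1 x2 ((a ^ 2 : ℝ) : ℂ) p =
      ((2 * π * (exp (-(a * √(x1 ^ 2 + x2 ^ 2 + z ^ 2))) / √(x1 ^ 2 + x2 ^ 2 + z ^ 2)) : ℝ) : ℂ) := by
  set E : ℝ × ℝ → ℝ → ℝ := fun p u =>
    exp (-(√(p.1 ^ 2 + p.2 ^ 2 + a ^ 2) ^ 2 * u ^ 2 + (z / 2) ^ 2 / u ^ 2)) with hE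
  set W : ℝ × ℝ → ℂ := fun p =>
    Complex.exp (Complex.I * ((p.1 * x1 + p.2 * x2 : ℝ) : ℂ)) with hW
  have hW1 (p : ℝ × ℝ) : ‖W p‖ = 1 := norm_exp_I_mul_ofReal_eq_one _
  have hEp (p : ℝ × ℝ) := integral_exp_neg_sq_add_inv_sq
    (sqrt_pos.2 (by positivity : 0 < p.1 ^ 2 + p.2 ^ 2 + a ^ 2)) (half_pos hz)
  have hEint (p : ℝ × ℝ) : ∫ u in Ioi (0 : ℝ), E p u = √π / 2 *
      (exp (-(z * √(p.1 ^ 2 + p.2 ^ 2 + a ^ 2))) / √(p.1 ^ 2 + p.2 ^ 2 + a ^ 2)) := by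
    rw [(hEp p).2.1, show 2 * √(p.1 ^ 2 + p.2 ^ 2 + a ^ 2) * (z / 2) =
      z * √(p.1 ^ 2 + p.2 ^ 2 + a ^ 2) by ring]
    field_simp
  have hinner (p : ℝ × ℝ) : ∫ u in Ioi (0 : ℝ), W p * (E p u : ℂ) =
      ((√π / 2 : ℝ) : ℂ) * weylKernel z x1 x2 ((a ^ 2 : ℝ) : ℂ) p := by
    rw [integral_const_mul, integral_complex_ofReal, hEint, weylKernel_eq_of_pos z x1 x2 ha,
      Complex.ofReal_mul, mul_left_comm]
  have hint : Integrable (Function.uncurry fun p u => W p * (E p u : ℂ))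
      ((volume : Measure (ℝ × ℝ)).prod (volume.restrict (Ioi 0))) := by
    refine (integrable_prod_iff ?_).2 ⟨ae_of_all _ fun p => ?_, ?_⟩
    · refine Measurable.aestronglyMeasurable ?_
      simp only [hW, hE, Function.uncurry_def]
      fun_prop
    · have h : Integrable (E p) (volume.restrict (Ioi 0)) := (hEp p).1
      exact h.ofReal.const_mul (W p)
    · refine ((integrable_weylBound hz (a ^ 2)).const_mul (√π / 2)).congr (ae_of_all _ fun p => ?_)
      have hn (u : ℝ) : ‖Function.uncurry (fun p u => W p * (E p u : ℂ)) (p, u)‖ = E p u := by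
        rw [Function.uncurry_apply_pair, norm_mul, hW1, one_mul, Complex.norm_real,
          norm_of_nonneg (exp_pos _).le]
      simp only [hn, hEint, weylBound]
      rw [abs_of_pos (by positivity)]
  have hswap := integral_integral_swap hint
  simp only [hinner] at hswap
  rw [integral_const_mul] at hswap
  have houter : ∀ u ∈ Ioi (0 : ℝ), ∫ p, W p * (E p u : ℂ) =
      ((π * ((u ^ 2)⁻¹ * exp (-(a ^ 2 * u ^ 2 +
        (√(x1 ^ 2 + x2 ^ 2 + z ^ 2) / 2) ^ 2 / u ^ 2))) : ℝ) : ℂ) := by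
    intro u hu
    have e (p : ℝ × ℝ) : W p * (E p u : ℂ) = W p *
        ((exp (-((p.1 ^ 2 + p.2 ^ 2) * u ^ 2)) : ℝ) : ℂ) *
        ((exp (-(a ^ 2 * u ^ 2 + (z / 2) ^ 2 / u ^ 2)) : ℝ) : ℂ) := by
      rw [mul_assoc, ← Complex.ofReal_mul, ← exp_add]
      congr 3
      simp only [hE]
      rw [sq_sqrt (by positivity)]
      ring_nf
    simp only [e]
    rw [integral_mul_const, integral_exp_I_mul_gaussian hu, ← Complex.ofReal_mul, mul_assoc,
      ← exp_add, div_eq_mul_inv, mul_assoc,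
      div_pow √(x1 ^ 2 + x2 ^ 2 + z ^ 2) 2, sq_sqrt (by positivity)]
    congr 4
    ring
  have hR : 0 < √(x1 ^ 2 + x2 ^ 2 + z ^ 2) := sqrt_pos.2 (by positivity)
  rw [setIntegral_congr_fun measurableSet_Ioi houter, integral_complex_ofReal, integral_const_mul,
    (integral_exp_neg_sq_add_inv_sq ha (half_pos hR)).2.2] at hswap
  have hpi : ((√π / 2 : ℝ) : ℂ) ≠ 0 := by
    rw [Complex.ofReal_ne_zero]
    positivity
  rw [← mul_right_inj' hpi, hswap, ← Complex.ofReal_mul]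
  congr 1
  rw [show 2 * a * (√(x1 ^ 2 + x2 ^ 2 + z ^ 2) / 2) = a * √(x1 ^ 2 + x2 ^ 2 + z ^ 2) by ring]
  field_simp
end

section
open Set Real Filter Topology

/-- The derivative of `weylKernel z x1 x2 s p` with respect to `s`. -/
def weylKernelDeriv (z x1 x2 : ℝ) (s : ℂ) (p : ℝ × ℝ) : ℂ :=
  Complex.exp (Complex.I * ((p.1 * x1 + p.2 * x2 : ℝ) : ℂ)) *
    -(Complex.exp (-(z * Complex.sqrt (((p.1 ^ 2 + p.2 ^ 2 : ℝ) : ℂ) + s))) *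
      ((z + 1 / Complex.sqrt (((p.1 ^ 2 + p.2 ^ 2 : ℝ) : ℂ) + s)) / 2) /
      (((p.1 ^ 2 + p.2 ^ 2 : ℝ) : ℂ) + s))

lemma measurable_weylKernelDeriv (z x1 x2 : ℝ) (s : ℂ) :
    Measurable (weylKernelDeriv z x1 x2 s) := by
  have := measurable_complex_sqrt
  unfold weylKernelDeriv
  fun_prop

lemma ofReal_add_mem_slitPlane {s : ℂ} (hs : s ∈ Complex.slitPlane) {t : ℝ} (ht : 0 ≤ t) :
    (t : ℂ) + s ∈ Complex.slitPlane := by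
  rw [Complex.mem_slitPlane_iff] at hs ⊢
  simp only [Complex.add_re, Complex.ofReal_re, Complex.add_im, Complex.ofReal_im, zero_add]
  rcases hs with h | h
  · exact Or.inl (by linarith)
  · exact Or.inr h

lemma hasDerivAt_weylKernel (z x1 x2 : ℝ) {s : ℂ} (hs : s ∈ Complex.slitPlane) (p : ℝ × ℝ) :
    HasDerivAt (fun s => weylKernel z x1 x2 s p) (weylKernelDeriv z x1 x2 s p) s := by
  have hq := ofReal_add_mem_slitPlane hs (by positivity : 0 ≤ p.1 ^ 2 + p.2 ^ 2)
  have h0 := Complex.slitPlane_ne_zero hq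
  have hw0 : Complex.sqrt (((p.1 ^ 2 + p.2 ^ 2 : ℝ) : ℂ) + s) ≠ 0 := by
    intro h
    apply h0
    rw [← complex_sqrt_sq (((p.1 ^ 2 + p.2 ^ 2 : ℝ) : ℂ) + s), h]
    simp
  have hw := (hasDerivAt_complex_sqrt hq).comp_const_add ((p.1 ^ 2 + p.2 ^ 2 : ℝ) : ℂ) s
  have h := (((hw.const_mul (z : ℂ)).fun_neg.cexp).fun_div hw hw0).const_mul
    (Complex.exp (Complex.I * ((p.1 * x1 + p.2 * x2 : ℝ) : ℂ)))
  refine h.congr_deriv ?_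
  rw [weylKernelDeriv]
  congr 1
  have h2 := complex_sqrt_sq (((p.1 ^ 2 + p.2 ^ 2 : ℝ) : ℂ) + s)
  generalize Complex.sqrt (((p.1 ^ 2 + p.2 ^ 2 : ℝ) : ℂ) + s) = w at *
  rw [← h2]
  field_simp
  ring

lemma norm_weylKernelDeriv_le {z ε m : ℝ} (hz : 0 < z) (hε : 0 < ε) (x1 x2 : ℝ) {s : ℂ}
    {p : ℝ × ℝ} (hq : ε ≤ ‖((p.1 ^ 2 + p.2 ^ 2 : ℝ) : ℂ) + s‖) (hm : ‖s‖ ≤ m ^ 2) :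
    ‖weylKernelDeriv z x1 x2 s p‖ ≤
      exp (-(z * √(p.1 ^ 2 + p.2 ^ 2 - m ^ 2))) * ((z + 1 / √ε) / 2 / ε) := by
  have h1 := norm_exp_neg_mul_sqrt_le hz (((p.1 ^ 2 + p.2 ^ 2 : ℝ) : ℂ) + s)
  simp only [Complex.add_re, Complex.ofReal_re] at h1
  have hre : p.1 ^ 2 + p.2 ^ 2 - m ^ 2 ≤ p.1 ^ 2 + p.2 ^ 2 + s.re := by
    linarith [neg_abs_le s.re, Complex.abs_re_le_norm s]
  rw [weylKernelDeriv, norm_mul, norm_exp_I_mul_ofReal_eq_one, one_mul, norm_neg, norm_div,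
    norm_mul, mul_div_assoc]
  have h2 : ‖((z : ℂ) + 1 / Complex.sqrt (((p.1 ^ 2 + p.2 ^ 2 : ℝ) : ℂ) + s)) / 2‖ ≤
      (z + 1 / √ε) / 2 := by
    rw [norm_div, Complex.norm_ofNat]
    gcongr
    refine (norm_add_le _ _).trans ?_
    rw [Complex.norm_real, norm_of_nonneg hz.le, norm_div, norm_one, norm_complex_sqrt]
    gcongr
  gcongr
  exact h1.trans (by gcongr)

lemma differentiableOn_integral_weylKernel {z : ℝ} (hz : 0 < z) (x1 x2 : ℝ) :
    DifferentiableOn ℂ (fun s => ∫ p, weylKernel z x1 x2 s p) Complex.slitPlane := by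
  intro s₀ hs₀
  obtain ⟨δ, hδ, hball⟩ := Metric.isOpen_iff.1 Complex.isOpen_slitPlane s₀ hs₀
  have hε : 0 < δ / 2 := half_pos hδ
  have hm : √(‖s₀‖ + δ / 2) ^ 2 = ‖s₀‖ + δ / 2 := sq_sqrt (by positivity)
  have hbound : ∀ p, ∀ s ∈ Metric.ball s₀ (δ / 2), ‖weylKernelDeriv z x1 x2 s p‖ ≤
      exp (-(z * √(p.1 ^ 2 + p.2 ^ 2 - √(‖s₀‖ + δ / 2) ^ 2))) *
        ((z + 1 / √(δ / 2)) / 2 / (δ / 2)) := by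
    intro p s hs
    rw [Metric.mem_ball, dist_eq_norm] at hs
    refine norm_weylKernelDeriv_le hz hε x1 x2 ?_ ?_
    · by_contra! hlt
      have hmem : ((-(p.1 ^ 2 + p.2 ^ 2) : ℝ) : ℂ) ∈ Complex.slitPlane := by
        apply hball
        rw [Metric.mem_ball, dist_eq_norm]
        calc ‖((-(p.1 ^ 2 + p.2 ^ 2) : ℝ) : ℂ) - s₀‖
            = ‖(s - s₀) - (((p.1 ^ 2 + p.2 ^ 2 : ℝ) : ℂ) + s)‖ := by
              congr 1
              push_cast
              ring
          _ ≤ ‖s - s₀‖ + ‖((p.1 ^ 2 + p.2 ^ 2 : ℝ) : ℂ) + s‖ := norm_sub_le _ _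
          _ < δ := by linarith
      rw [Complex.ofReal_mem_slitPlane] at hmem
      nlinarith [sq_nonneg p.1, sq_nonneg p.2]
    · rw [hm]
      have := norm_add_le s₀ (s - s₀)
      rw [add_sub_cancel] at this
      linarith
  have hderiv : ∀ p, ∀ s ∈ Metric.ball s₀ (δ / 2),
      HasDerivAt (fun s => weylKernel z x1 x2 s p) (weylKernelDeriv z x1 x2 s p) s :=
    fun p s hs =>
      hasDerivAt_weylKernel z x1 x2 (hball (Metric.ball_subset_ball (by linarith) hs)) p
  have h := hasDerivAt_integral_of_dominated_loc_of_deriv_le (Metric.ball_mem_nhds s₀ hε)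
    (Eventually.of_forall fun s => (measurable_weylKernel z x1 x2 s).aestronglyMeasurable)
    (integrable_weylKernel hz x1 x2 s₀)
    (measurable_weylKernelDeriv z x1 x2 s₀).aestronglyMeasurable
    (ae_of_all _ hbound) ((integrable_exp_neg_mul_sqrt hz _).mul_const _) (ae_of_all _ hderiv)
  exact h.2.differentiableAt.differentiableWithinAt

lemma integral_weylKernel {z : ℝ} (hz : 0 < z) (x1 x2 : ℝ) {s : ℂ}
    (hs : s ∈ Complex.slitPlane) :
    ∫ p, weylKernel z x1 x2 s p =
      2 * π * (Complex.exp (-(Complex.sqrt s * (√(x1 ^ 2 + x2 ^ 2 + z ^ 2) : ℝ))) /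
        (√(x1 ^ 2 + x2 ^ 2 + z ^ 2) : ℝ)) := by
  have hf := (differentiableOn_integral_weylKernel hz x1 x2).analyticOnNhd Complex.isOpen_slitPlane
  have hg : AnalyticOnNhd ℂ (fun s : ℂ => 2 * π *
      (Complex.exp (-(Complex.sqrt s * (√(x1 ^ 2 + x2 ^ 2 + z ^ 2) : ℝ))) /
        (√(x1 ^ 2 + x2 ^ 2 + z ^ 2) : ℝ))) Complex.slitPlane := by
    refine DifferentiableOn.analyticOnNhd (fun s hs => ?_) Complex.isOpen_slitPlane
    have := (hasDerivAt_complex_sqrt hs).differentiableAt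
    exact DifferentiableAt.differentiableWithinAt (by fun_prop)
  refine hf.eqOn_of_preconnected_of_frequently_eq hg
    (Complex.starConvex_one_slitPlane.isPathConnected
      Complex.one_mem_slitPlane).isConnected.isPreconnected Complex.one_mem_slitPlane ?_ hs
  have ht : Tendsto (fun t : ℝ => (t : ℂ)) (𝓝[≠] 1) (𝓝[≠] 1) := by
    refine tendsto_nhdsWithin_of_tendsto_nhds_of_eventually_within _ ?_ ?_
    · exact (Complex.continuous_ofReal.tendsto' 1 1 Complex.ofReal_one).mono_left
        nhdsWithin_le_nhds
    · filter_upwards [self_mem_nhdsWithin] with t ht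
      simpa using ht
  refine ht.frequently (Eventually.frequently ?_)
  filter_upwards [nhdsWithin_le_nhds (Ioi_mem_nhds (zero_lt_one' ℝ))] with t ht
  have ht0 : 0 < t := ht
  have h := integral_weylKernel_of_pos hz (sqrt_pos.2 ht0) x1 x2
  rw [sq_sqrt ht0.le] at h
  rw [h, Complex.sqrt_of_nonneg (by rw [Complex.zero_le_real]; exact ht0.le), Complex.ofReal_re]
  push_cast
  rfl

end

section
open Set Real Filter Topology

lemma tendsto_complex_sqrt_sub_mul_I (c : ℝ) :
    Tendsto (fun ε : ℝ => Complex.sqrt ((c : ℂ) - ε * Complex.I)) (𝓝[>] 0)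
      (𝓝 ((√((|c| + c) / 2) : ℝ) - (√((|c| - c) / 2) : ℝ) * Complex.I)) := by
  have h : Tendsto (fun ε : ℝ => ((√((‖(c : ℂ) - ε * Complex.I‖ + c) / 2) : ℝ) : ℂ) -
      (√((‖(c : ℂ) - ε * Complex.I‖ - c) / 2) : ℝ) * Complex.I) (𝓝[>] 0)
      (𝓝 ((√((|c| + c) / 2) : ℝ) - (√((|c| - c) / 2) : ℝ) * Complex.I)) := by
    refine Tendsto.mono_left (Continuous.tendsto' (by fun_prop) _ _ ?_) nhdsWithin_le_nhds
    simp
  refine h.congr' ?_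
  filter_upwards [self_mem_nhdsWithin] with ε hε
  have him : ¬ (0 ≤ -ε) := by
    simpa using hε
  rw [Complex.sqrt_eq_real_add_ite]
  simp [him]
  ring

lemma kappaC_eq (k0 k1 k2 : ℝ) :
    kappaC k0 k1 k2 = (√(k0 ^ 2 - k1 ^ 2 - k2 ^ 2) : ℝ) +
      (√(k1 ^ 2 + k2 ^ 2 - k0 ^ 2) : ℝ) * Complex.I := by
  unfold kappaC
  split_ifs with h
  · rw [sqrt_eq_zero_of_nonpos (by linarith : k1 ^ 2 + k2 ^ 2 - k0 ^ 2 ≤ 0)]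
    simp
  · rw [sqrt_eq_zero_of_nonpos (by linarith : k0 ^ 2 - k1 ^ 2 - k2 ^ 2 ≤ 0)]
    simp [mul_comm]

lemma measurable_kappaC (k0 : ℝ) : Measurable (fun p : ℝ × ℝ => kappaC k0 p.1 p.2) := by
  simp only [kappaC_eq]
  fun_prop

lemma norm_kappaC (k0 k1 k2 : ℝ) : ‖kappaC k0 k1 k2‖ = √|k1 ^ 2 + k2 ^ 2 + -k0 ^ 2| := by
  unfold kappaC
  split_ifs with h
  · rw [Complex.norm_real, norm_of_nonneg (sqrt_nonneg _), abs_of_nonpos (by linarith)]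
    congr 1
    ring
  · rw [norm_mul, Complex.norm_I, one_mul, Complex.norm_real, norm_of_nonneg (sqrt_nonneg _),
      abs_of_nonneg (by linarith), sub_eq_add_neg]

lemma tendsto_complex_sqrt_kappaC (k0 : ℝ) (p : ℝ × ℝ) :
    Tendsto (fun ε : ℝ => Complex.sqrt (((p.1 ^ 2 + p.2 ^ 2 : ℝ) : ℂ) +
      (((-k0 ^ 2 : ℝ) : ℂ) - ε * Complex.I))) (𝓝[>] 0)
      (𝓝 (-(Complex.I * kappaC k0 p.1 p.2))) := by
  have h := tendsto_complex_sqrt_sub_mul_I (p.1 ^ 2 + p.2 ^ 2 + -k0 ^ 2)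
  convert! h using 1
  · ext ε
    push_cast
    ring_nf
  · congr 1
    unfold kappaC
    split_ifs with h
    · rw [abs_of_nonpos (by linarith)]
      have e1 : (-(p.1 ^ 2 + p.2 ^ 2 + -k0 ^ 2) + (p.1 ^ 2 + p.2 ^ 2 + -k0 ^ 2)) / 2 = 0 := by ring
      have e2 : (-(p.1 ^ 2 + p.2 ^ 2 + -k0 ^ 2) - (p.1 ^ 2 + p.2 ^ 2 + -k0 ^ 2)) / 2 =
        k0 ^ 2 - p.1 ^ 2 - p.2 ^ 2 := by ring
      rw [e1, e2]
      simp [mul_comm]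
    · rw [abs_of_nonneg (by linarith)]
      have e1 : ((p.1 ^ 2 + p.2 ^ 2 + -k0 ^ 2) + (p.1 ^ 2 + p.2 ^ 2 + -k0 ^ 2)) / 2 =
        p.1 ^ 2 + p.2 ^ 2 - k0 ^ 2 := by ring
      have e2 : ((p.1 ^ 2 + p.2 ^ 2 + -k0 ^ 2) - (p.1 ^ 2 + p.2 ^ 2 + -k0 ^ 2)) / 2 = 0 := by ring
      rw [e1, e2, ← mul_assoc, Complex.I_mul_I]
      simp

/-- The plane-wave integrand of the Weyl representation of `exp (i k₀ R) / R`. -/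
def planeWave (k0 : ℝ) (x : ℝ × ℝ × ℝ) (p : ℝ × ℝ) : ℂ :=
  (kappaC k0 p.1 p.2)⁻¹ *
    Complex.exp (Complex.I * (((p.1 * x.1 + p.2 * x.2.1 : ℝ) : ℂ) + kappaC k0 p.1 p.2 * (x.2.2 : ℂ)))

lemma norm_planeWave (k0 : ℝ) (x : ℝ × ℝ × ℝ) (p : ℝ × ℝ) :
    ‖planeWave k0 x p‖ = weylBound x.2.2 (-k0 ^ 2) p := by
  rw [planeWave, norm_mul, norm_inv, norm_kappaC, mul_add, Complex.exp_add, norm_mul,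
    norm_exp_I_mul_ofReal_eq_one, one_mul, Complex.norm_exp, weylBound, div_eq_inv_mul]
  congr 2
  rw [kappaC_eq, sub_eq_add_neg (p.1 ^ 2 + p.2 ^ 2)]
  simp [mul_comm]

/-- The Weyl representation of the outgoing fundamental solution of the Helmholtz equation. -/
lemma integral_planeWave {k0 : ℝ} (hk0 : 0 < k0) {x : ℝ × ℝ × ℝ} (hx : 0 < x.2.2) :
    ∫ p, planeWave k0 x p = -(2 * π * Complex.I) *
      (Complex.exp (Complex.I * k0 * (√(x.1 ^ 2 + x.2.1 ^ 2 + x.2.2 ^ 2) : ℝ)) /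
        (√(x.1 ^ 2 + x.2.1 ^ 2 + x.2.2 ^ 2) : ℝ)) := by
  have hlhs : Tendsto (fun ε : ℝ => ∫ p, weylKernel x.2.2 x.1 x.2.1
      (((-k0 ^ 2 : ℝ) : ℂ) - ε * Complex.I) p) (𝓝[>] 0)
      (𝓝 (∫ p, Complex.I * planeWave k0 x p)) := by
    refine tendsto_integral_filter_of_dominated_convergence (weylBound x.2.2 (-k0 ^ 2))
      (Eventually.of_forall fun ε => (measurable_weylKernel _ _ _ _).aestronglyMeasurable)
      (Eventually.of_forall fun ε => ?_) (integrable_weylBound hx _) ?_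
    · have hre : (((-k0 ^ 2 : ℝ) : ℂ) - ε * Complex.I).re = -k0 ^ 2 := by
        rw [Complex.sub_re, Complex.ofReal_re]
        simp
      filter_upwards [ae_sq_add_sq_ne (k0 ^ 2)] with p hp
      have h := norm_weylKernel_le hx x.1 x.2.1 (((-k0 ^ 2 : ℝ) : ℂ) - ε * Complex.I) (p := p)
      rw [hre] at h
      exact h fun h0 => hp (by linarith)
    · filter_upwards [ae_sq_add_sq_ne (k0 ^ 2)] with p hp
      have hκ : kappaC k0 p.1 p.2 ≠ 0 := by
        rw [← norm_pos_iff, norm_kappaC]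
        exact sqrt_pos.2 (abs_pos.2 fun h0 => hp (by linarith))
      have hs := tendsto_complex_sqrt_kappaC k0 p
      have h := ((((hs.const_mul (x.2.2 : ℂ)).neg).cexp).div hs
        (neg_ne_zero.2 (mul_ne_zero Complex.I_ne_zero hκ))).const_mul
        (Complex.exp (Complex.I * ((p.1 * x.1 + p.2 * x.2.1 : ℝ) : ℂ)))
      convert! h using 2
      rw [planeWave, mul_add, Complex.exp_add,
        show -((x.2.2 : ℂ) * -(Complex.I * kappaC k0 p.1 p.2)) =
          Complex.I * (kappaC k0 p.1 p.2 * x.2.2) by ring]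
      field_simp
      rw [Complex.I_sq]
  have hsqrt : Tendsto (fun ε : ℝ => Complex.sqrt (((-k0 ^ 2 : ℝ) : ℂ) - ε * Complex.I)) (𝓝[>] 0)
      (𝓝 (-(Complex.I * k0))) := by
    have h := tendsto_complex_sqrt_kappaC k0 (0, 0)
    have e : kappaC k0 0 0 = k0 := by
      rw [kappaC, if_pos (by linarith [sq_nonneg k0])]
      simp [sqrt_sq hk0.le]
    simpa [e] using h
  have hrhs := (((hsqrt.mul_const ((√(x.1 ^ 2 + x.2.1 ^ 2 + x.2.2 ^ 2) : ℝ) : ℂ)).neg.cexp).div_const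
    ((√(x.1 ^ 2 + x.2.1 ^ 2 + x.2.2 ^ 2) : ℝ) : ℂ)).const_mul (2 * (π : ℂ))
  have heq := tendsto_nhds_unique (hlhs.congr' (by
    filter_upwards [self_mem_nhdsWithin] with ε hε
    refine integral_weylKernel hx x.1 x.2.1 ?_
    rw [Complex.mem_slitPlane_iff]
    right
    rw [Complex.sub_im, Complex.ofReal_im]
    simpa using (ne_of_gt hε))) hrhs
  rw [integral_const_mul] at heq
  have hI : ∫ p, planeWave k0 x p = -Complex.I * (Complex.I * ∫ p, planeWave k0 x p) := by
    rw [← mul_assoc, neg_mul, Complex.I_mul_I, neg_neg, one_mul]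
  rw [hI, heq, neg_mul (Complex.I * (k0 : ℂ)), neg_neg]
  ring

end

lemma integrable_source_mul_planeWave {k0 r rM : ℝ} (hrM : r < rM) {g : ℝ × ℝ × ℝ → ℂ}
    (hg : Continuous g) (hgi : Integrable g) (hsupp : ∀ y, g y ≠ 0 → y.2.2 < r) (r1 r2 : ℝ) :
    Integrable (Function.uncurry fun (y : ℝ × ℝ × ℝ) (p : ℝ × ℝ) =>
      g y * planeWave k0 (r1 - y.1, r2 - y.2.1, rM - y.2.2) p) (volume.prod volume) := by
  refine (hgi.norm.mul_prod (integrable_weylBound (sub_pos.2 hrM) (-k0 ^ 2))).mono' ?_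
    (ae_of_all _ fun z => ?_)
  · have h1 := hg.measurable
    have h2 : Measurable fun z : (ℝ × ℝ × ℝ) × ℝ × ℝ => kappaC k0 z.2.1 z.2.2 :=
      (measurable_kappaC k0).comp measurable_snd
    refine Measurable.aestronglyMeasurable ?_
    simp only [Function.uncurry_def, planeWave]
    fun_prop
  · simp only [Function.uncurry_def, norm_mul, norm_planeWave]
    by_cases h : g z.1 = 0
    · simp [h]
    · gcongr
      exact weylBound_antitone_left (by linarith [hsupp _ h]) _

lemma integral_source_mul_planeWave (k0 r1 r2 rM : ℝ) (g : ℝ × ℝ × ℝ → ℂ) (p : ℝ × ℝ) :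
    (kappaC k0 p.1 p.2)⁻¹ *
      Complex.exp (Complex.I *
        (((p.1 * r1 + p.2 * r2 : ℝ) : ℂ) + kappaC k0 p.1 p.2 * (rM : ℂ))) *
      FT3c g p.1 p.2 (kappaC k0 p.1 p.2) =
    (((2 * Real.pi) ^ (-(3 : ℝ) / 2) : ℝ) : ℂ) *
      ∫ y : ℝ × ℝ × ℝ, g y * planeWave k0 (r1 - y.1, r2 - y.2.1, rM - y.2.2) p := by
  rw [FT3c, mul_left_comm, ← integral_const_mul]
  congr 2
  ext y
  have h : Complex.exp (Complex.I * (((p.1 * (r1 - y.1) + p.2 * (r2 - y.2.1) : ℝ) : ℂ) +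
      kappaC k0 p.1 p.2 * ((rM - y.2.2 : ℝ) : ℂ))) =
      Complex.exp (Complex.I *
        (((p.1 * r1 + p.2 * r2 : ℝ) : ℂ) + kappaC k0 p.1 p.2 * (rM : ℂ))) *
      Complex.exp (-Complex.I * ((p.1 : ℂ) * (y.1 : ℂ) + (p.2 : ℂ) * (y.2.1 : ℂ) +
        kappaC k0 p.1 p.2 * (y.2.2 : ℂ))) := by
    rw [← Complex.exp_add]
    congr 1
    push_cast
    ring
  rw [planeWave, h]
  ring

lemma sqrt_two_pi_mul_inv_rpow :
    (((2 * Real.pi) ^ (-(3 : ℝ) / 2) : ℝ) : ℂ) =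
      ((Real.sqrt (2 * Real.pi) : ℝ) : ℂ) / (2 * Real.pi) ^ 2 := by
  have h : 0 < 2 * Real.pi := by positivity
  have e : (2 * Real.pi) ^ (-(3 : ℝ) / 2) = Real.sqrt (2 * Real.pi) / (2 * Real.pi) ^ 2 := by
    rw [Real.sqrt_eq_rpow, ← Real.rpow_natCast, ← Real.rpow_sub h]
    norm_num
  rw [e]
  push_cast
  rfl

theorem stmt17 (k0 r rM : ℝ) (hk0 : 0 < k0) (hr : 0 < r) (hrM : r < rM)
    (g : ℝ × ℝ × ℝ → ℂ) (hg : Continuous g)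
    (hsupp : Function.support g ⊆ {x : ℝ × ℝ × ℝ | x.1 ^ 2 + x.2.1 ^ 2 + x.2.2 ^ 2 < r ^ 2}) :
    ∀ r1 r2 : ℝ,
      Integrable (fun p : ℝ × ℝ =>
        (kappaC k0 p.1 p.2)⁻¹ *
          Complex.exp (Complex.I *
            (((p.1 * r1 + p.2 * r2 : ℝ) : ℂ) + kappaC k0 p.1 p.2 * (rM : ℂ))) *
          FT3c g p.1 p.2 (kappaC k0 p.1 p.2)) volume ∧
      uSol k0 g (r1, r2, rM) =
        Complex.I / (2 * ((Real.sqrt (2 * Real.pi) : ℝ) : ℂ)) *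
          ∫ p : ℝ × ℝ,
            (kappaC k0 p.1 p.2)⁻¹ *
              Complex.exp (Complex.I *
                (((p.1 * r1 + p.2 * r2 : ℝ) : ℂ) + kappaC k0 p.1 p.2 * (rM : ℂ))) *
              FT3c g p.1 p.2 (kappaC k0 p.1 p.2) := by
  intro r1 r2
  have hzero (y : ℝ × ℝ × ℝ) (hy : g y ≠ 0) : y.1 ^ 2 + y.2.1 ^ 2 + y.2.2 ^ 2 < r ^ 2 := hsupp hy
  have hgi : Integrable g := by
    refine hg.integrable_of_hasCompactSupport (HasCompactSupport.intro
      (isCompact_Icc : IsCompact (Set.Icc ((-r, -r, -r) : ℝ × ℝ × ℝ) (r, r, r))) fun y hy => ?_)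
    by_contra h
    have h' := hzero y h
    have h1 := abs_le_of_sq_le_sq' (by nlinarith [sq_nonneg y.2.1, sq_nonneg y.2.2] :
      y.1 ^ 2 ≤ r ^ 2) hr.le
    have h2 := abs_le_of_sq_le_sq' (by nlinarith [sq_nonneg y.1, sq_nonneg y.2.2] :
      y.2.1 ^ 2 ≤ r ^ 2) hr.le
    have h3 := abs_le_of_sq_le_sq' (by nlinarith [sq_nonneg y.1, sq_nonneg y.2.1] :
      y.2.2 ^ 2 ≤ r ^ 2) hr.le
    exact hy ⟨⟨h1.1, h2.1, h3.1⟩, ⟨h1.2, h2.2, h3.2⟩⟩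
  have hz (y : ℝ × ℝ × ℝ) (hy : g y ≠ 0) : y.2.2 < r :=
    lt_of_pow_lt_pow_left₀ 2 hr.le (by nlinarith [hzero y hy, sq_nonneg y.1, sq_nonneg y.2.1])
  have hint := integrable_source_mul_planeWave (k0 := k0) hrM hg hgi hz r1 r2
  simp only [integral_source_mul_planeWave]
  refine ⟨hint.integral_prod_right.const_mul _, ?_⟩
  rw [integral_const_mul, ← integral_integral_swap hint, uSol, ← mul_assoc, ← integral_const_mul]
  congr 1
  ext y
  rw [integral_const_mul]
  by_cases hy : g y = 0
  · simp [hy]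
  have hpos : 0 < rM - y.2.2 := by linarith [hz y hy]
  rw [integral_planeWave hk0 (x := (r1 - y.1, r2 - y.2.1, rM - y.2.2)) hpos,
    sqrt_two_pi_mul_inv_rpow]
  have hR : ((Real.sqrt ((r1 - y.1) ^ 2 + (r2 - y.2.1) ^ 2 + (rM - y.2.2) ^ 2) : ℝ) : ℂ) ≠ 0 := by
    rw [Complex.ofReal_ne_zero]
    exact (Real.sqrt_pos.2 (by positivity)).ne'
  have hs : ((Real.sqrt (2 * Real.pi) : ℝ) : ℂ) ≠ 0 := by
    rw [Complex.ofReal_ne_zero]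
    positivity
  have hpi : (Real.pi : ℂ) ≠ 0 := by exact_mod_cast Real.pi_ne_zero
  dsimp only
  field_simp
  rw [Complex.I_sq]
  ring
end
end
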